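/- With n = n_k = 2^k k, liminf_{k→∞} P( X(k,k) > 0 ) ≥ 1/(4π + 1). -/

import Mathlib

open Filter Real

/-- A "configuration" in a graph `G`: two disjoint nonempty cliques `X₁, X₂` with no
edges between them, together with a vertex `x` outside both that is adjacent to every
vertex of `X₁ ∪ X₂`, such that every vertex outside `X₁ ∪ X₂` has a neighbor in `X₁`
and a neighbor in `X₂`. -/
def IsConfig {n : ℕ} (G : SimpleGraph (Fin n)) (X₁ X₂ : Finset (Fin n)) (x : Fin n) : Prop :=
  X₁.Nonempty ∧ X₂.Nonempty ∧ Disjoint X₁ X₂ ∧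
  x ∉ X₁ ∧ x ∉ X₂ ∧
  (∀ u ∈ X₁, ∀ v ∈ X₁, u ≠ v → G.Adj u v) ∧
  (∀ u ∈ X₂, ∀ v ∈ X₂, u ≠ v → G.Adj u v) ∧
  (∀ u ∈ X₁, ∀ v ∈ X₂, ¬ G.Adj u v) ∧
  (∀ u ∈ X₁, G.Adj x u) ∧ (∀ u ∈ X₂, G.Adj x u) ∧
  (∀ y : Fin n, y ∉ X₁ → y ∉ X₂ →
    (∃ u ∈ X₁, G.Adj y u) ∧ (∃ u ∈ X₂, G.Adj y u))

/-- Property `P` of a graph: existence of a configuration. -/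
def PropertyP {n : ℕ} (G : SimpleGraph (Fin n)) : Prop :=
  ∃ (X₁ X₂ : Finset (Fin n)) (x : Fin n), IsConfig G X₁ X₂ x

/-- The probability, under the uniform distribution on graphs on `{1, …, n}`,
of the set of graphs satisfying `Q`. -/
noncomputable def unifProb (n : ℕ) (Q : SimpleGraph (Fin n) → Prop) : ℝ :=
  (Nat.card {G : SimpleGraph (Fin n) // Q G} : ℝ) / 2 ^ (n.choose 2)

/-- `Xcount n k l G` is the number of ordered triples `(X₁, X₂, x)` forming a
configuration in `G` with `|X₁| = k` and `|X₂| = l`. -/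
noncomputable def Xcount (n k l : ℕ) (G : SimpleGraph (Fin n)) : ℕ :=
  Nat.card {t : Finset (Fin n) × Finset (Fin n) × Fin n //
    t.1.card = k ∧ t.2.1.card = l ∧ IsConfig G t.1 t.2.1 t.2.2}

/-- The expectation of a random variable `Y` under the uniform distribution on graphs
on `{1, …, n}`. -/
noncomputable def expect (n : ℕ) (Y : SimpleGraph (Fin n) → ℝ) : ℝ :=
  (∑ G : SimpleGraph (Fin n), Y G) / 2 ^ (n.choose 2)

open Finset

open Classical in
/-- The real indicator of a proposition. -/
noncomputable def propInd (p : Prop) : ℝ := if p then 1 else 0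

lemma propInd_of_true {p : Prop} (h : p) : propInd p = 1 := if_pos h

lemma propInd_of_false {p : Prop} (h : ¬ p) : propInd p = 0 := if_neg h

lemma propInd_nonneg (p : Prop) : 0 ≤ propInd p := by
  by_cases h : p <;> simp [h, propInd_of_true, propInd_of_false]

lemma propInd_mono {p q : Prop} (h : p → q) : propInd p ≤ propInd q := by
  by_cases hp : p
  · rw [propInd_of_true hp, propInd_of_true (h hp)]
  · rw [propInd_of_false hp]
    exact propInd_nonneg q

lemma propInd_and (p q : Prop) : propInd (p ∧ q) = propInd p * propInd q := by
  by_cases h : p <;> by_cases h' : q <;> simp [h, h', propInd_of_true, propInd_of_false]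

lemma propInd_not (p : Prop) : propInd (¬ p) = 1 - propInd p := by
  by_cases h : p <;> simp [h, propInd_of_true, propInd_of_false]

section DependsOnPairs

variable {V : Type*}

/-- `Q` depends only on the pairs in `S`. -/
def DependsOnPairs (S : Set (Sym2 V)) (Q : SimpleGraph V → Prop) : Prop :=
  ∀ G H : SimpleGraph V, (∀ e ∈ S, e ∈ G.edgeSet ↔ e ∈ H.edgeSet) → Q G → Q H

/-- The graph that agrees with `G` on the pairs in `S` and with `H` elsewhere. -/
def spliceGraph (S : Set (Sym2 V)) (G H : SimpleGraph V) : SimpleGraph V :=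
  SimpleGraph.fromEdgeSet {e | (e ∈ S ∧ e ∈ G.edgeSet) ∨ (e ∉ S ∧ e ∈ H.edgeSet)}

lemma mem_edgeSet_spliceGraph (S : Set (Sym2 V)) (G H : SimpleGraph V) (e : Sym2 V) :
    e ∈ (spliceGraph S G H).edgeSet ↔ (e ∈ S ∧ e ∈ G.edgeSet) ∨ (e ∉ S ∧ e ∈ H.edgeSet) := by
  have h1 := @SimpleGraph.not_isDiag_of_mem_edgeSet V G e
  have h2 := @SimpleGraph.not_isDiag_of_mem_edgeSet V H e
  simp only [spliceGraph, SimpleGraph.edgeSet_fromEdgeSet, Set.mem_sdiff, Set.mem_ofPred_eq,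
    Sym2.mem_diagSet]
  tauto

lemma spliceGraph_spliceGraph (S : Set (Sym2 V)) (G H : SimpleGraph V) :
    spliceGraph S (spliceGraph S G H) (spliceGraph S H G) = G := by
  rw [← SimpleGraph.edgeSet_inj]
  ext e
  simp only [mem_edgeSet_spliceGraph]
  tauto

lemma DependsOnPairs.forall_mem {ι : Type*} {I : Finset ι} {S : ι → Set (Sym2 V)}
    {A : ι → SimpleGraph V → Prop} (hA : ∀ i ∈ I, DependsOnPairs (S i) (A i)) :
    DependsOnPairs (⋃ i ∈ I, S i) (fun G => ∀ i ∈ I, A i G) := by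
  intro G H h hG i hi
  exact hA i hi G H (fun e he => h e (Set.mem_biUnion (by exact hi) he)) (hG i hi)

end DependsOnPairs

section PairsIn

variable {V : Type*} [DecidableEq V]

/-- The pairs of distinct elements of `W`. -/
def pairsIn (W : Finset V) : Finset (Sym2 V) := W.offDiag.image (Function.uncurry Sym2.mk)

lemma mk_mem_pairsIn {W : Finset V} {u v : V} :
    s(u, v) ∈ pairsIn W ↔ u ∈ W ∧ v ∈ W ∧ u ≠ v := by
  simp only [pairsIn, mem_image, mem_offDiag, Prod.exists, Function.uncurry_apply_pair]
  constructor
  · rintro ⟨a, b, h, hab⟩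
    rw [Sym2.eq_iff] at hab
    grind
  · intro h
    exact ⟨u, v, h, rfl⟩

lemma card_pairsIn (W : Finset V) : #(pairsIn W) = (#W).choose 2 :=
  Sym2.card_image_offDiag W

lemma not_isDiag_of_mem_pairsIn {W : Finset V} {e : Sym2 V} (he : e ∈ pairsIn W) :
    ¬ e.IsDiag := by
  induction e with | _ u v =>
  exact (mk_mem_pairsIn.1 he).2.2

lemma pairsIn_inter (W W' : Finset V) : pairsIn W ∩ pairsIn W' = pairsIn (W ∩ W') := by
  ext e
  induction e with | _ u v =>
  simp only [mem_inter, mk_mem_pairsIn]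
  tauto

end PairsIn

section GraphProb

variable {V : Type*} [Fintype V] [DecidableEq V]

/-- The probability of `Q` under the uniform distribution on the simple graphs on `V`. -/
noncomputable def graphProb (Q : SimpleGraph V → Prop) : ℝ :=
  (∑ G : SimpleGraph V, propInd (Q G)) / Fintype.card (SimpleGraph V)

lemma card_simpleGraph_pos : (0 : ℝ) < Fintype.card (SimpleGraph V) := by
  exact_mod_cast Fintype.card_pos_iff.2 ⟨(⊥ : SimpleGraph V)⟩

lemma graphProb_nonneg (Q : SimpleGraph V → Prop) : 0 ≤ graphProb Q := by
  exact div_nonneg (sum_nonneg fun G _ => propInd_nonneg _) (card_simpleGraph_pos (V := V)).le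

lemma graphProb_mono {Q R : SimpleGraph V → Prop} (h : ∀ G, Q G → R G) :
    graphProb Q ≤ graphProb R := by
  unfold graphProb
  gcongr with G
  exact propInd_mono (h G)

lemma graphProb_true : graphProb (fun _ : SimpleGraph V => True) = 1 := by
  simp [graphProb, propInd_of_true, (card_simpleGraph_pos (V := V)).ne']

lemma graphProb_le_one (Q : SimpleGraph V → Prop) : graphProb Q ≤ 1 :=
  graphProb_true (V := V) ▸ graphProb_mono fun _ _ => trivial

lemma graphProb_false {Q : SimpleGraph V → Prop} (h : ∀ G, ¬ Q G) : graphProb Q = 0 := by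
  simp [graphProb, h, propInd_of_false]

lemma graphProb_and {S T : Set (Sym2 V)} {A B : SimpleGraph V → Prop}
    (hA : DependsOnPairs S A) (hB : DependsOnPairs T B) (hST : Disjoint S T) :
    graphProb (fun G => A G ∧ B G) = graphProb A * graphProb B := by
  classical
  have hT : ∀ e ∈ T, e ∉ S := fun e he hs => Set.disjoint_left.1 hST hs he
  have key : (∑ p : SimpleGraph V × SimpleGraph V, propInd (A p.1) * propInd (B p.1)) =
      ∑ p : SimpleGraph V × SimpleGraph V, propInd (A p.1) * propInd (B p.2) := by
    refine Fintype.sum_bijective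
      (fun p : SimpleGraph V × SimpleGraph V => (spliceGraph S p.1 p.2, spliceGraph S p.2 p.1))
      (Function.Involutive.bijective fun p => ?_) _ _ fun p => ?_
    · simp [spliceGraph_spliceGraph]
    · have h1 : A p.1 ↔ A (spliceGraph S p.1 p.2) := by
        constructor <;> refine hA _ _ fun e he => ?_ <;> rw [mem_edgeSet_spliceGraph] <;> tauto
      have h2 : B p.1 ↔ B (spliceGraph S p.2 p.1) := by
        constructor <;> refine hB _ _ fun e he => ?_ <;> rw [mem_edgeSet_spliceGraph] <;>
          have := hT e he <;> tauto
      simp only [h1, h2]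
  have hpos := (card_simpleGraph_pos (V := V)).ne'
  rw [Fintype.sum_prod_type, Fintype.sum_prod_type] at key
  simp only [sum_const, card_univ, nsmul_eq_mul] at key
  unfold graphProb
  rw [div_mul_div_comm, div_eq_div_iff hpos (mul_ne_zero hpos hpos), ← mul_assoc]
  congr 1
  simp only [propInd_and]
  rw [mul_comm, mul_sum, key, sum_mul_sum]

lemma graphProb_forall {ι : Type*} (I : Finset ι) {S : ι → Set (Sym2 V)}
    {A : ι → SimpleGraph V → Prop} (hA : ∀ i ∈ I, DependsOnPairs (S i) (A i))
    (hS : ∀ i ∈ I, ∀ j ∈ I, i ≠ j → Disjoint (S i) (S j)) :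
    graphProb (fun G => ∀ i ∈ I, A i G) = ∏ i ∈ I, graphProb (A i) := by
  classical
  induction I using Finset.induction_on with
  | empty => simpa using graphProb_true
  | insert a I ha ih =>
    rw [prod_insert ha, ← ih (fun i hi => hA i (mem_insert_of_mem hi))
      (fun i hi j hj => hS i (mem_insert_of_mem hi) j (mem_insert_of_mem hj)),
      ← graphProb_and (hA a (mem_insert_self a I))
        (DependsOnPairs.forall_mem fun i hi => hA i (mem_insert_of_mem hi))]
    · simp only [forall_mem_insert]
    · simp only [Set.disjoint_iUnion_right]
      exact fun i hi => hS a (mem_insert_self a I) i (mem_insert_of_mem hi)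
        (fun h => ha (h ▸ hi))

lemma graphProb_add_not (Q : SimpleGraph V → Prop) :
    graphProb Q + graphProb (fun G => ¬ Q G) = 1 := by
  rw [← graphProb_true (V := V)]
  simp only [graphProb, ← add_div, ← sum_add_distrib, propInd_not]
  congr 1
  refine sum_congr rfl fun G _ => ?_
  rw [propInd_of_true trivial, add_sub_cancel]

lemma graphProb_mem_edgeSet {e : Sym2 V} (he : ¬ e.IsDiag) :
    graphProb (fun G : SimpleGraph V => e ∈ G.edgeSet) = 1 / 2 := by
  have key : graphProb (fun G : SimpleGraph V => e ∈ G.edgeSet) =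
      graphProb (fun G : SimpleGraph V => e ∉ G.edgeSet) := by
    unfold graphProb
    congr 1
    have hmem : ∀ G : SimpleGraph V, ∀ f, f ∈ (spliceGraph {e} Gᶜ G).edgeSet ↔
        ((f = e ∧ e ∉ G.edgeSet) ∨ (f ≠ e ∧ f ∈ G.edgeSet)) := by
      intro G f
      rw [mem_edgeSet_spliceGraph]
      have : e ∈ Gᶜ.edgeSet ↔ e ∉ G.edgeSet := by
        induction e with | _ u v =>
        simp only [Sym2.mk_isDiag_iff] at he
        simp [he]
      simp only [Set.mem_singleton_iff]
      constructor
      · rintro (⟨rfl, h⟩ | h)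
        · exact Or.inl ⟨rfl, this.1 h⟩
        · exact Or.inr h
      · rintro (⟨rfl, h⟩ | h)
        · exact Or.inl ⟨rfl, this.2 h⟩
        · exact Or.inr h
    refine Fintype.sum_bijective (fun G : SimpleGraph V => spliceGraph {e} Gᶜ G)
      (Function.Involutive.bijective fun G => ?_) _ _ fun G => ?_
    · rw [← SimpleGraph.edgeSet_inj]
      ext f
      simp only [hmem]
      by_cases hf : f = e
      · subst hf; simp
      · simp [hf]
    · by_cases h : e ∈ G.edgeSet <;> simp [hmem, h]
  have := graphProb_add_not (fun G : SimpleGraph V => e ∈ G.edgeSet)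
  rw [← key] at this
  linarith

lemma graphProb_edges_eq {F : Finset (Sym2 V)} (hF : ∀ e ∈ F, ¬ e.IsDiag) (c : Sym2 V → Prop) :
    graphProb (fun G : SimpleGraph V => ∀ e ∈ F, (e ∈ G.edgeSet ↔ c e)) = (1 / 2) ^ #F := by
  rw [graphProb_forall F (S := fun e => {e}) (A := fun e G => (e ∈ G.edgeSet ↔ c e)),
    ← prod_const]
  · refine prod_congr rfl fun e he => ?_
    by_cases hc : c e
    · simpa [hc] using graphProb_mem_edgeSet (hF e he)
    · have := graphProb_add_not (fun G : SimpleGraph V => e ∈ G.edgeSet)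
      rw [graphProb_mem_edgeSet (hF e he)] at this
      simp only [hc, iff_false]
      linarith
  · intro e _ G H h
    exact fun hG => (h e rfl).symm.trans hG
  · intro i _ j _ hij
    simpa using hij

lemma card_simpleGraph_eq : (Fintype.card (SimpleGraph V) : ℝ) =
    2 ^ (Fintype.card V).choose 2 := by
  have h := graphProb_edges_eq (F := pairsIn (univ : Finset V))
    (fun e he => not_isDiag_of_mem_pairsIn he) (fun _ => False)
  have h2 : ∀ G : SimpleGraph V,
      (∀ e ∈ pairsIn (univ : Finset V), (e ∈ G.edgeSet ↔ False)) ↔ G = ⊥ := by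
    intro G
    constructor
    · intro hG
      rw [← SimpleGraph.edgeSet_eq_empty]
      ext e
      induction e with | _ u v =>
      simp only [Set.mem_empty_iff_false, iff_false]
      intro he
      exact (hG _ (mk_mem_pairsIn.2 ⟨mem_univ _, mem_univ _,
        fun h => SimpleGraph.not_isDiag_of_mem_edgeSet _ he h⟩)).1 he
    · rintro rfl
      simp
  have h3 : graphProb (fun G : SimpleGraph V => G = ⊥) = (1 / 2) ^ (Fintype.card V).choose 2 := by
    rw [← card_univ, ← card_pairsIn, ← h]
    exact congrArg graphProb (funext fun G => propext (h2 G).symm)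
  rw [graphProb, sum_eq_single_of_mem ⊥ (mem_univ _) (fun G _ hG => propInd_of_false hG),
    propInd_of_true rfl] at h3
  have hpos := (card_simpleGraph_pos (V := V)).ne'
  rw [div_eq_iff hpos, one_div, inv_pow] at h3
  field_simp at h3
  exact h3.symm

end GraphProb

section Neighbors

variable {V : Type*}

/-- The vertex `y` has a neighbor in `U`. -/
def HasNbr (y : V) (U : Finset V) (G : SimpleGraph V) : Prop := ∃ u ∈ U, G.Adj y u

/-- The pairs joining `y` to a vertex of `W`. -/
def starPairs (y : V) (W : Finset V) : Set (Sym2 V) := {e | ∃ u ∈ W, e = s(y, u)}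

lemma starPairs_disjoint {y z : V} {W : Finset V} (hy : y ∉ W) (hyz : y ≠ z) :
    Disjoint (starPairs y W) (starPairs z W) := by
  rw [Set.disjoint_left]
  rintro e ⟨u, hu, rfl⟩ ⟨v, hv, h⟩
  rw [Sym2.eq_iff] at h
  rcases h with ⟨h, -⟩ | ⟨h, -⟩
  · exact hyz h
  · exact hy (h ▸ hv)

lemma HasNbr.dependsOnPairs {y : V} {U W : Finset V} (h : U ⊆ W) :
    DependsOnPairs (starPairs y W) (HasNbr y U) := by
  rintro G H hGH ⟨u, hu, hadj⟩
  exact ⟨u, hu, (hGH s(y, u) ⟨u, h hu, rfl⟩).1 hadj⟩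

lemma DependsOnPairs.and {S : Set (Sym2 V)} {A B : SimpleGraph V → Prop}
    (hA : DependsOnPairs S A) (hB : DependsOnPairs S B) :
    DependsOnPairs S (fun G => A G ∧ B G) :=
  fun G H h hG => ⟨hA G H h hG.1, hB G H h hG.2⟩

lemma dependsOnPairs_edges_eq (F : Finset (Sym2 V)) (c : Sym2 V → Prop) :
    DependsOnPairs (F : Set (Sym2 V)) (fun G => ∀ e ∈ F, (e ∈ G.edgeSet ↔ c e)) :=
  fun _ _ h hG e he => (h e he).symm.trans (hG e he)

lemma pairsIn_disjoint_starPairs [DecidableEq V] {y : V} {W W' : Finset V} (hy : y ∉ W) :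
    Disjoint (pairsIn W : Set (Sym2 V)) (starPairs y W') := by
  rw [Set.disjoint_left]
  rintro e he ⟨v, hv, rfl⟩
  exact hy (mk_mem_pairsIn.1 he).1

variable [Fintype V] [DecidableEq V]

lemma graphProb_not_hasNbr {y : V} {U : Finset V} (hy : y ∉ U) :
    graphProb (fun G => ¬ HasNbr y U G) = (1 / 2) ^ #U := by
  have hinj : Set.InjOn (fun u => s(y, u)) U := by
    intro u _ v _ h
    exact Sym2.congr_right.1 h
  rw [← card_image_of_injOn hinj, ← graphProb_edges_eq (fun e he => ?_) (fun _ => False)]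
  · congr 1
    funext G
    simp [HasNbr]
  · obtain ⟨u, hu, rfl⟩ := mem_image.1 he
    rw [Sym2.mk_isDiag_iff]
    rintro rfl
    exact hy hu

lemma graphProb_hasNbr_and {y : V} {U W : Finset V} (hU : y ∉ U) (hW : y ∉ W)
    (h : Disjoint U W) :
    graphProb (fun G => HasNbr y U G ∧ HasNbr y W G) =
      (1 - (1 / 2) ^ #U) * (1 - (1 / 2) ^ #W) := by
  rw [graphProb_and (HasNbr.dependsOnPairs (Subset.refl U)) (HasNbr.dependsOnPairs (Subset.refl W))]
  · have h1 := graphProb_add_not (HasNbr y U)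
    have h2 := graphProb_add_not (HasNbr y W)
    rw [graphProb_not_hasNbr ‹_›] at h1 h2
    rw [← eq_sub_iff_add_eq] at h1 h2
    rw [h1, h2]
  · rw [Set.disjoint_left]
    rintro e ⟨u, hu, rfl⟩ ⟨v, hv, huv⟩
    have : u = v := Sym2.congr_right.1 huv
    exact Finset.disjoint_left.1 h hu (this ▸ hv)

lemma graphProb_not_hasNbr_and_le {y : V} {U W : Finset V} (hU : y ∉ U) (hW : y ∉ W)
    {k s : ℕ} (hUk : #U = k) (hWk : #W = k) (h : #(U ∩ W) ≤ s) :
    graphProb (fun G => ¬ HasNbr y U G ∧ ¬ HasNbr y W G) ≤ 2 ^ s * ((1 / 2) ^ k) ^ 2 := by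
  have h1 : (fun G => ¬ HasNbr y U G ∧ ¬ HasNbr y W G) = fun G => ¬ HasNbr y (U ∪ W) G := by
    funext G
    simp only [HasNbr, mem_union, eq_iff_iff]
    grind
  rw [h1, graphProb_not_hasNbr (by simp [hU, hW])]
  have h2 := card_union_add_card_inter U W
  have h3 : (2 : ℝ) ^ s * ((1 / 2) ^ k) ^ 2 = 2 ^ s * (1 / 2) ^ (#(U ∪ W) + #(U ∩ W)) := by
    rw [h2, hUk, hWk]; ring
  rw [h3, pow_add, mul_left_comm]
  refine le_mul_of_one_le_right (by positivity) ?_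
  calc (1 : ℝ) = 2 ^ #(U ∩ W) * (1 / 2) ^ #(U ∩ W) := by rw [← mul_pow]; norm_num
    _ ≤ _ := by gcongr; norm_num

lemma graphProb_and_four_le (A B C D : SimpleGraph V → Prop) :
    graphProb (fun G => (A G ∧ B G) ∧ (C G ∧ D G)) ≤
      1 - (graphProb (fun G => ¬ A G) + graphProb (fun G => ¬ B G) +
        graphProb (fun G => ¬ C G) + graphProb (fun G => ¬ D G)) +
      (graphProb (fun G => ¬ A G ∧ ¬ B G) + graphProb (fun G => ¬ A G ∧ ¬ C G) +
        graphProb (fun G => ¬ A G ∧ ¬ D G) + graphProb (fun G => ¬ B G ∧ ¬ C G) +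
        graphProb (fun G => ¬ B G ∧ ¬ D G) + graphProb (fun G => ¬ C G ∧ ¬ D G)) := by
  rw [← graphProb_true (V := V)]
  simp only [graphProb, ← add_div, ← sub_div, ← sum_add_distrib, ← sum_sub_distrib]
  refine div_le_div_of_nonneg_right (sum_le_sum fun G _ => ?_) card_simpleGraph_pos.le
  simp only [propInd_and, propInd_not, propInd_of_true trivial]
  by_cases hA : A G <;> by_cases hB : B G <;> by_cases hC : C G <;> by_cases hD : D G <;>
    simp only [hA, hB, hC, hD, propInd_of_true trivial, propInd_of_false not_false] <;> norm_num

end Neighbors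

section Triples

variable {n : ℕ}

/-- The vertex set `X₁ ∪ X₂ ∪ {x}` of the triple `(X₁, X₂, x)`. -/
def tripleSupport (t : Finset (Fin n) × Finset (Fin n) × Fin n) : Finset (Fin n) :=
  insert t.2.2 (t.1 ∪ t.2.1)

/-- The triples `(X₁, X₂, x)` with `X₁`, `X₂` disjoint of size `k` and `x ∉ X₁ ∪ X₂`. -/
def triples (n k : ℕ) : Finset (Finset (Fin n) × Finset (Fin n) × Fin n) :=
  {t | #t.1 = k ∧ #t.2.1 = k ∧ Disjoint t.1 t.2.1 ∧ t.2.2 ∉ t.1 ∧ t.2.2 ∉ t.2.1}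

/-- The pairs that are edges inside the support of a configuration. -/
def TriplePattern (t : Finset (Fin n) × Finset (Fin n) × Fin n) (e : Sym2 (Fin n)) : Prop :=
  (∀ a ∈ e, a ∈ insert t.2.2 t.1) ∨ (∀ a ∈ e, a ∈ insert t.2.2 t.2.1)

/-- The triple `t` is a configuration in `G`. -/
def IsConfigTriple (t : Finset (Fin n) × Finset (Fin n) × Fin n) (G : SimpleGraph (Fin n)) :
    Prop :=
  IsConfig G t.1 t.2.1 t.2.2

lemma mem_triples {k : ℕ} {t : Finset (Fin n) × Finset (Fin n) × Fin n} :
    t ∈ triples n k ↔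
      #t.1 = k ∧ #t.2.1 = k ∧ Disjoint t.1 t.2.1 ∧ t.2.2 ∉ t.1 ∧ t.2.2 ∉ t.2.1 := by
  simp [triples]

lemma card_tripleSupport {k : ℕ} {t : Finset (Fin n) × Finset (Fin n) × Fin n}
    (ht : t ∈ triples n k) : #(tripleSupport t) = 2 * k + 1 := by
  obtain ⟨h1, h2, h3, h4, h5⟩ := mem_triples.1 ht
  rw [tripleSupport, card_insert_of_notMem (by simp [h4, h5]), card_union_of_disjoint h3]
  omega

lemma isConfigTriple_iff {k : ℕ} (hk : 1 ≤ k) {t : Finset (Fin n) × Finset (Fin n) × Fin n}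
    (ht : t ∈ triples n k) (G : SimpleGraph (Fin n)) :
    IsConfigTriple t G ↔
      (∀ e ∈ pairsIn (tripleSupport t), (e ∈ G.edgeSet ↔ TriplePattern t e)) ∧
      ∀ y ∈ (tripleSupport t)ᶜ, HasNbr y t.1 G ∧ HasNbr y t.2.1 G := by
  obtain ⟨X, Y, x⟩ := t
  obtain ⟨h1, h2, h3, h4, h5⟩ := mem_triples.1 ht
  simp only at h1 h2 h3 h4 h5
  have hX : X.Nonempty := card_pos.1 (by omega)
  have hY : Y.Nonempty := card_pos.1 (by omega)
  have hXY : ∀ a, a ∈ X → a ∉ Y := fun a ha hb => Finset.disjoint_left.1 h3 ha hb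
  have hpat : (∀ e ∈ pairsIn (tripleSupport (X, Y, x)),
      (e ∈ G.edgeSet ↔ TriplePattern (X, Y, x) e)) ↔
      ∀ u ∈ insert x (X ∪ Y), ∀ v ∈ insert x (X ∪ Y), u ≠ v →
        (G.Adj u v ↔ (u ∈ insert x X ∧ v ∈ insert x X) ∨ (u ∈ insert x Y ∧ v ∈ insert x Y)) := by
    constructor
    · intro h u hu v hv huv
      have := h s(u, v) (mk_mem_pairsIn.2 ⟨hu, hv, huv⟩)
      simpa only [SimpleGraph.mem_edgeSet, TriplePattern, Sym2.mem_iff, forall_eq_or_imp,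
        forall_eq] using this
    · intro h e he
      induction e with | _ u v =>
      obtain ⟨hu, hv, huv⟩ := mk_mem_pairsIn.1 he
      simpa only [SimpleGraph.mem_edgeSet, TriplePattern, Sym2.mem_iff, forall_eq_or_imp,
        forall_eq] using h u hu v hv huv
  rw [hpat]
  simp only [IsConfigTriple, IsConfig, tripleSupport, HasNbr, mem_compl, mem_insert, mem_union]
  constructor
  · rintro ⟨-, -, -, -, -, c1, c2, c3, c4, c5, c6⟩
    refine ⟨?_, fun y hy => c6 y (by tauto) (by tauto)⟩
    intro u hu v hv huv
    have c3' : ∀ u ∈ Y, ∀ v ∈ X, ¬ G.Adj u v := fun u hu v hv h => c3 v hv u hu h.symm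
    have c4' : ∀ u ∈ X, G.Adj u x := fun u hu => (c4 u hu).symm
    have c5' : ∀ u ∈ Y, G.Adj u x := fun u hu => (c5 u hu).symm
    rcases hu with rfl | hu | hu <;> rcases hv with rfl | hv | hv <;> grind
  · rintro ⟨c, d⟩
    have hx : ∀ u ∈ X, x ≠ u := fun u hu h => h4 (h ▸ hu)
    have hy : ∀ u ∈ Y, x ≠ u := fun u hu h => h5 (h ▸ hu)
    have hxX : ∀ u ∈ X, G.Adj x u := fun u hu =>
      (c x (by simp) u (by simp [hu]) (hx u hu)).2 (by simp [hu])
    have hxY : ∀ u ∈ Y, G.Adj x u := fun u hu =>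
      (c x (by simp) u (by simp [hu]) (hy u hu)).2 (by simp [hu])
    refine ⟨hX, hY, h3, h4, h5, ?_, ?_, ?_, hxX, hxY, ?_⟩
    · exact fun u hu v hv huv => (c u (by simp [hu]) v (by simp [hv]) huv).2 (by simp [hu, hv])
    · exact fun u hu v hv huv => (c u (by simp [hu]) v (by simp [hv]) huv).2 (by simp [hu, hv])
    · intro u hu v hv huv
      have := (c u (by simp [hu]) v (by simp [hv]) huv.ne).1 huv
      grind
    · intro y hyX hyY
      by_cases hyx : y = x
      · subst hyx
        obtain ⟨a, ha⟩ := hX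
        obtain ⟨b, hb⟩ := hY
        exact ⟨⟨a, ha, hxX a ha⟩, ⟨b, hb, hxY b hb⟩⟩
      · exact d y (by tauto)

lemma fst_subset_tripleSupport (t : Finset (Fin n) × Finset (Fin n) × Fin n) :
    t.1 ⊆ tripleSupport t :=
  subset_union_left.trans (subset_insert _ _)

lemma snd_subset_tripleSupport (t : Finset (Fin n) × Finset (Fin n) × Fin n) :
    t.2.1 ⊆ tripleSupport t :=
  subset_union_right.trans (subset_insert _ _)

lemma graphProb_isConfigTriple {k : ℕ} (hk : 1 ≤ k)
    {t : Finset (Fin n) × Finset (Fin n) × Fin n} (ht : t ∈ triples n k) :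
    graphProb (IsConfigTriple t) =
      (1 / 2) ^ (2 * k + 1).choose 2 * ((1 - (1 / 2) ^ k) ^ 2) ^ (n - (2 * k + 1)) := by
  obtain ⟨h1, h2, h3, h4, h5⟩ := mem_triples.1 ht
  have h : IsConfigTriple t = fun G => (∀ e ∈ pairsIn (tripleSupport t),
      (e ∈ G.edgeSet ↔ TriplePattern t e)) ∧
      ∀ y ∈ (tripleSupport t)ᶜ, HasNbr y t.1 G ∧ HasNbr y t.2.1 G :=
    funext fun G => propext (isConfigTriple_iff hk ht G)
  have hdep : ∀ y ∈ (tripleSupport t)ᶜ, DependsOnPairs (starPairs y (tripleSupport t))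
      (fun G => HasNbr y t.1 G ∧ HasNbr y t.2.1 G) := fun y _ =>
    (HasNbr.dependsOnPairs (fst_subset_tripleSupport t)).and
      (HasNbr.dependsOnPairs (snd_subset_tripleSupport t))
  rw [h, graphProb_and (dependsOnPairs_edges_eq _ _) (DependsOnPairs.forall_mem hdep),
    graphProb_edges_eq (fun e => not_isDiag_of_mem_pairsIn), card_pairsIn, card_tripleSupport ht,
    graphProb_forall _ hdep]
  · congr 1
    have hn : n - (2 * k + 1) = #(tripleSupport t)ᶜ := by
      rw [card_compl, Fintype.card_fin, card_tripleSupport ht]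
    rw [hn, ← prod_const]
    refine prod_congr rfl fun y hy => ?_
    rw [mem_compl] at hy
    rw [graphProb_hasNbr_and (fun h => hy (fst_subset_tripleSupport t h))
      (fun h => hy (snd_subset_tripleSupport t h)) h3, h1, h2, sq]
  · intro y hy z _ hyz
    exact starPairs_disjoint (mem_compl.1 hy) hyz
  · simp only [Set.disjoint_iUnion_right]
    exact fun y hy => pairsIn_disjoint_starPairs (mem_compl.1 hy)

lemma graphProb_isConfigTriple_and_le {k : ℕ} (hk : 1 ≤ k)
    {t t' : Finset (Fin n) × Finset (Fin n) × Fin n} (ht : t ∈ triples n k)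
    (ht' : t' ∈ triples n k) {s : ℕ} (hs : #(tripleSupport t ∩ tripleSupport t') = s) {q : ℝ}
    (hq : ∀ y, y ∉ tripleSupport t → y ∉ tripleSupport t' →
      graphProb (fun G => (HasNbr y t.1 G ∧ HasNbr y t.2.1 G) ∧
        (HasNbr y t'.1 G ∧ HasNbr y t'.2.1 G)) ≤ q) :
    graphProb (fun G => IsConfigTriple t G ∧ IsConfigTriple t' G) ≤
      (1 / 2) ^ (2 * (2 * k + 1).choose 2 - s.choose 2) *
        q ^ (n - (2 * (2 * k + 1) - s)) := by
  classical
  set W := tripleSupport t with hW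
  set W' := tripleSupport t' with hW'
  set c : Sym2 (Fin n) → Prop := fun e =>
    (e ∈ pairsIn W ∧ TriplePattern t e) ∨ (e ∉ pairsIn W ∧ TriplePattern t' e) with hc
  have hdep : ∀ y ∈ (W ∪ W')ᶜ, DependsOnPairs (starPairs y (W ∪ W'))
      (fun G => (HasNbr y t.1 G ∧ HasNbr y t.2.1 G) ∧ (HasNbr y t'.1 G ∧ HasNbr y t'.2.1 G)) :=
    fun y _ =>
    ((HasNbr.dependsOnPairs ((fst_subset_tripleSupport t).trans subset_union_left)).and
      (HasNbr.dependsOnPairs ((snd_subset_tripleSupport t).trans subset_union_left))).and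
    ((HasNbr.dependsOnPairs ((fst_subset_tripleSupport t').trans subset_union_right)).and
      (HasNbr.dependsOnPairs ((snd_subset_tripleSupport t').trans subset_union_right)))
  have hcard : #(W ∪ W') = 2 * (2 * k + 1) - s := by
    have := card_union_add_card_inter W W'
    rw [hs, card_tripleSupport ht, card_tripleSupport ht'] at this
    omega
  have hcard2 : #(pairsIn W ∪ pairsIn W') = 2 * (2 * k + 1).choose 2 - s.choose 2 := by
    have := card_union_add_card_inter (pairsIn W) (pairsIn W')
    rw [pairsIn_inter, card_pairsIn, card_pairsIn, card_pairsIn, hs, card_tripleSupport ht,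
      card_tripleSupport ht'] at this
    omega
  calc graphProb (fun G => IsConfigTriple t G ∧ IsConfigTriple t' G)
      ≤ graphProb (fun G => (∀ e ∈ pairsIn W ∪ pairsIn W', (e ∈ G.edgeSet ↔ c e)) ∧
          ∀ y ∈ (W ∪ W')ᶜ, (HasNbr y t.1 G ∧ HasNbr y t.2.1 G) ∧
            (HasNbr y t'.1 G ∧ HasNbr y t'.2.1 G)) := by
        refine graphProb_mono fun G hG => ?_
        rw [isConfigTriple_iff hk ht, isConfigTriple_iff hk ht'] at hG
        obtain ⟨⟨a1, a2⟩, b1, b2⟩ := hG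
        refine ⟨fun e he => ?_, fun y hy => ?_⟩
        · by_cases h : e ∈ pairsIn W
          · simp [hc, h, a1 e h]
          · have := b1 e ((mem_union.1 he).resolve_left h)
            simp [hc, h, this]
        · rw [mem_compl, mem_union, not_or] at hy
          exact ⟨a2 y (mem_compl.2 hy.1), b2 y (mem_compl.2 hy.2)⟩
    _ = (1 / 2) ^ (2 * (2 * k + 1).choose 2 - s.choose 2) *
        ∏ y ∈ (W ∪ W')ᶜ, graphProb (fun G => (HasNbr y t.1 G ∧ HasNbr y t.2.1 G) ∧
            (HasNbr y t'.1 G ∧ HasNbr y t'.2.1 G)) := by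
        rw [graphProb_and (dependsOnPairs_edges_eq _ _) (DependsOnPairs.forall_mem hdep),
          graphProb_edges_eq, hcard2, graphProb_forall _ hdep]
        · intro y hy z _ hyz
          exact starPairs_disjoint (mem_compl.1 hy) hyz
        · intro e he
          rcases mem_union.1 he with he | he <;> exact not_isDiag_of_mem_pairsIn he
        · simp only [Set.disjoint_iUnion_right, coe_union, Set.disjoint_union_left]
          intro y hy
          rw [mem_compl, mem_union, not_or] at hy
          exact ⟨pairsIn_disjoint_starPairs hy.1, pairsIn_disjoint_starPairs hy.2⟩
    _ ≤ _ := by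
        have hn : n - (2 * (2 * k + 1) - s) = #(W ∪ W')ᶜ := by
          rw [card_compl, Fintype.card_fin, hcard]
        rw [hn, ← prod_const]
        refine mul_le_mul_of_nonneg_left (prod_le_prod (fun y _ => graphProb_nonneg _)
          fun y hy => ?_) (by positivity)
        rw [mem_compl, mem_union, not_or] at hy
        exact hq y hy.1 hy.2

lemma graphProb_hasNbr_four_le {k : ℕ} {t t' : Finset (Fin n) × Finset (Fin n) × Fin n}
    (ht : t ∈ triples n k) (ht' : t' ∈ triples n k) {s : ℕ}
    (hs : #(tripleSupport t ∩ tripleSupport t') = s) {y : Fin n}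
    (hy : y ∉ tripleSupport t) (hy' : y ∉ tripleSupport t') :
    graphProb (fun G => (HasNbr y t.1 G ∧ HasNbr y t.2.1 G) ∧
        (HasNbr y t'.1 G ∧ HasNbr y t'.2.1 G)) ≤
      1 - 4 * (1 / 2) ^ k + 6 * (2 ^ s * ((1 / 2) ^ k) ^ 2) := by
  obtain ⟨h1, h2, h3, -, -⟩ := mem_triples.1 ht
  obtain ⟨h1', h2', h3', -, -⟩ := mem_triples.1 ht'
  have s1 := fst_subset_tripleSupport t
  have s2 := snd_subset_tripleSupport t
  have s1' := fst_subset_tripleSupport t'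
  have s2' := snd_subset_tripleSupport t'
  have n1 : y ∉ t.1 := fun h => hy (s1 h)
  have n2 : y ∉ t.2.1 := fun h => hy (s2 h)
  have n1' : y ∉ t'.1 := fun h => hy' (s1' h)
  have n2' : y ∉ t'.2.1 := fun h => hy' (s2' h)
  refine (graphProb_and_four_le _ _ _ _).trans ?_
  rw [graphProb_not_hasNbr n1, graphProb_not_hasNbr n2, graphProb_not_hasNbr n1',
    graphProb_not_hasNbr n2', h1, h2, h1', h2']
  have e1 := graphProb_not_hasNbr_and_le (s := s) n1 n2 h1 h2
    (by rw [disjoint_iff_inter_eq_empty.1 h3]; simp)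
  have e2 := graphProb_not_hasNbr_and_le (s := s) n1' n2' h1' h2'
    (by rw [disjoint_iff_inter_eq_empty.1 h3']; simp)
  have e3 := graphProb_not_hasNbr_and_le n1 n1' h1 h1' (hs ▸ card_le_card (inter_subset_inter s1 s1'))
  have e4 := graphProb_not_hasNbr_and_le n1 n2' h1 h2' (hs ▸ card_le_card (inter_subset_inter s1 s2'))
  have e5 := graphProb_not_hasNbr_and_le n2 n1' h2 h1' (hs ▸ card_le_card (inter_subset_inter s2 s1'))
  have e6 := graphProb_not_hasNbr_and_le n2 n2' h2 h2' (hs ▸ card_le_card (inter_subset_inter s2 s2'))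
  linarith

lemma graphProb_hasNbr_four_le_sq {k : ℕ} {t t' : Finset (Fin n) × Finset (Fin n) × Fin n}
    (ht : t ∈ triples n k) {y : Fin n} (hy : y ∉ tripleSupport t) :
    graphProb (fun G => (HasNbr y t.1 G ∧ HasNbr y t.2.1 G) ∧
        (HasNbr y t'.1 G ∧ HasNbr y t'.2.1 G)) ≤ (1 - (1 / 2) ^ k) ^ 2 := by
  obtain ⟨h1, h2, h3, -, -⟩ := mem_triples.1 ht
  refine (graphProb_mono fun G hG => hG.1).trans_eq ?_
  rw [graphProb_hasNbr_and (fun h => hy (fst_subset_tripleSupport t h))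
    (fun h => hy (snd_subset_tripleSupport t h)) h3, h1, h2, sq]

end Triples

section Counting

variable {n : ℕ}

lemma triple_snd_eq {k : ℕ} {t : Finset (Fin n) × Finset (Fin n) × Fin n} (ht : t ∈ triples n k) :
    t.2.1 = ((tripleSupport t).erase t.2.2) \ t.1 := by
  obtain ⟨-, -, h3, h4, h5⟩ := mem_triples.1 ht
  rw [Finset.disjoint_left] at h3
  ext a
  grind [tripleSupport]

lemma fst_subset_erase {k : ℕ} {t : Finset (Fin n) × Finset (Fin n) × Fin n}
    (ht : t ∈ triples n k) : t.1 ⊆ (tripleSupport t).erase t.2.2 := by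
  obtain ⟨-, -, -, h4, -⟩ := mem_triples.1 ht
  exact fun a ha => mem_erase.2 ⟨fun h => h4 (h ▸ ha), fst_subset_tripleSupport t ha⟩

lemma snd_mem_tripleSupport (t : Finset (Fin n) × Finset (Fin n) × Fin n) :
    t.2.2 ∈ tripleSupport t :=
  mem_insert_self _ _

lemma card_triples_support_eq {k : ℕ} {W : Finset (Fin n)} (hW : #W = 2 * k + 1) :
    #{t ∈ triples n k | tripleSupport t = W} = (2 * k + 1) * (2 * k).choose k := by
  have h1 : #(W.sigma fun x => powersetCard k (W.erase x)) = (2 * k + 1) * (2 * k).choose k := by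
    rw [card_sigma, sum_congr rfl (g := fun _ => (2 * k).choose k), sum_const, hW, smul_eq_mul]
    intro x hx
    rw [card_powersetCard, card_erase_of_mem hx, hW]
    rfl
  rw [← h1]
  refine card_bij' (fun t _ => ⟨t.2.2, t.1⟩) (fun p _ => (p.2, (W.erase p.1) \ p.2, p.1))
    ?_ ?_ ?_ ?_
  · intro t ht
    obtain ⟨ht1, ht2⟩ := mem_filter.1 ht
    exact mem_sigma.2 ⟨ht2 ▸ snd_mem_tripleSupport t,
      mem_powersetCard.2 ⟨ht2 ▸ fst_subset_erase ht1, (mem_triples.1 ht1).1⟩⟩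
  · rintro ⟨x, X⟩ hp
    obtain ⟨hx, hX⟩ := mem_sigma.1 hp
    obtain ⟨hX, hXk⟩ := mem_powersetCard.1 hX
    simp only at hx hX hXk
    refine mem_filter.2 ⟨mem_triples.2 ⟨hXk, ?_, disjoint_sdiff, ?_, ?_⟩, ?_⟩
    · rw [card_sdiff_of_subset hX, card_erase_of_mem hx, hW, hXk]
      omega
    · exact fun h => (mem_erase.1 (hX h)).1 rfl
    · simp
    · ext a
      have := @hX a
      simp only [tripleSupport, mem_insert, mem_union, mem_erase] at this ⊢
      grind
  · intro t ht
    obtain ⟨ht1, ht2⟩ := mem_filter.1 ht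
    simp only
    rw [← ht2, ← triple_snd_eq ht1]
  · intro p _
    rfl

lemma card_triples (n k : ℕ) :
    #(triples n k) = n.choose (2 * k + 1) * ((2 * k + 1) * (2 * k).choose k) := by
  rw [card_eq_sum_card_fiberwise (f := tripleSupport)
    (t := powersetCard (2 * k + 1) (univ : Finset (Fin n))), sum_congr rfl
      (g := fun _ => (2 * k + 1) * (2 * k).choose k), sum_const, card_powersetCard, card_univ,
      Fintype.card_fin, smul_eq_mul]
  · exact fun W hW => card_triples_support_eq (mem_powersetCard.1 hW).2
  · exact fun t ht => mem_powersetCard.2 ⟨subset_univ _, card_tripleSupport ht⟩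

lemma card_sets_inter_eq_le {m s : ℕ} {W : Finset (Fin n)} (hW : #W = m) :
    #{W' ∈ powersetCard m (univ : Finset (Fin n)) | #(W ∩ W') = s} ≤
      m.choose s * (n - m).choose (m - s) := by
  have h : m.choose s * (n - m).choose (m - s) =
      #(powersetCard s W ×ˢ powersetCard (m - s) Wᶜ) := by
    rw [card_product, card_powersetCard, card_powersetCard, card_compl, hW, Fintype.card_fin]
  rw [h]
  refine card_le_card_of_injOn (fun W' => (W ∩ W', W' \ W)) (fun W' hW' => ?_) ?_
  · obtain ⟨h1, h2⟩ := mem_filter.1 hW'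
    have h3 := (mem_powersetCard.1 h1).2
    refine mem_product.2 ⟨mem_powersetCard.2 ⟨inter_subset_left, h2⟩,
      mem_powersetCard.2 ⟨fun a ha => ?_, ?_⟩⟩
    · exact mem_compl.2 (mem_sdiff.1 ha).2
    · simp only [card_sdiff, h2, h3]
  · intro A _ B _ hAB
    simp only [Prod.mk.injEq] at hAB
    rw [← sdiff_union_inter A W, ← sdiff_union_inter B W, inter_comm A, inter_comm B, hAB.1, hAB.2]

lemma card_triples_filter_inter_le {k s c : ℕ} {W : Finset (Fin n)} (hW : #W = 2 * k + 1)
    (P : Finset (Fin n) × Finset (Fin n) × Fin n → Prop) [DecidablePred P]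
    (hc : ∀ W', #(W ∩ W') = s → #W' = 2 * k + 1 →
      #{t ∈ triples n k | P t ∧ tripleSupport t = W'} ≤ c) :
    #{t ∈ triples n k | #(W ∩ tripleSupport t) = s ∧ P t} ≤
      c * ((2 * k + 1).choose s * (n - (2 * k + 1)).choose (2 * k + 1 - s)) := by
  refine (card_le_mul_card_image_of_maps_to (f := tripleSupport)
    (t := {W' ∈ powersetCard (2 * k + 1) (univ : Finset (Fin n)) | #(W ∩ W') = s})
    (fun t ht => ?_) c (fun W' hW' => ?_)).trans (Nat.mul_le_mul_left _ (card_sets_inter_eq_le hW))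
  · obtain ⟨h1, h2, -⟩ := mem_filter.1 ht
    exact mem_filter.2 ⟨mem_powersetCard.2 ⟨subset_univ _, card_tripleSupport h1⟩, h2⟩
  · obtain ⟨h1, h2⟩ := mem_filter.1 hW'
    refine (card_le_card fun t ht => ?_).trans (hc W' h2 (mem_powersetCard.1 h1).2)
    simp only [mem_filter] at ht ⊢
    tauto

/-- Both triples are configurations in a common graph. -/
def CompatibleTriples (t t' : Finset (Fin n) × Finset (Fin n) × Fin n) : Prop :=
  ∃ G : SimpleGraph (Fin n), IsConfigTriple t G ∧ IsConfigTriple t' G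

lemma CompatibleTriples.fst_inter {t t' : Finset (Fin n) × Finset (Fin n) × Fin n}
    (h : CompatibleTriples t t') {U : Finset (Fin n)} (hU : U ⊆ t.1 ∪ t.2.1)
    (hU' : U ⊆ t'.1 ∪ t'.2.1) :
    U ∩ t'.1 = U ∩ t.1 ∨ U ∩ t'.1 = U ∩ t.2.1 := by
  obtain ⟨G, ⟨-, -, a3, -, -, a6, a7, a8, -, -, -⟩, ⟨-, -, b3, -, -, b6, b7, b8, -, -, -⟩⟩ := h
  rw [Finset.disjoint_left] at a3 b3
  have hU1 : ∀ u ∈ U, u ∈ t.1 ∨ u ∈ t.2.1 := fun u hu => mem_union.1 (hU hu)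
  have hU2 : ∀ u ∈ U, u ∈ t'.1 ∨ u ∈ t'.2.1 := fun u hu => mem_union.1 (hU' hu)
  have same : ∀ u ∈ U, ∀ v ∈ U, (u ∈ t.1 ↔ v ∈ t.1) ↔ (u ∈ t'.1 ↔ v ∈ t'.1) := by
    have e1 : ∀ u ∈ U, ∀ v ∈ U, u ≠ v → ((u ∈ t.1 ↔ v ∈ t.1) ↔ G.Adj u v) := by
      intro u hu v hv huv
      have := a6 u; have := a7 u; have := a8 u; have := a8 v
      have := G.adj_comm u v
      rcases hU1 u hu with h | h <;> rcases hU1 v hv with h' | h' <;> grind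
    have e2 : ∀ u ∈ U, ∀ v ∈ U, u ≠ v → ((u ∈ t'.1 ↔ v ∈ t'.1) ↔ G.Adj u v) := by
      intro u hu v hv huv
      have := b6 u; have := b7 u; have := b8 u; have := b8 v
      have := G.adj_comm u v
      rcases hU2 u hu with h | h <;> rcases hU2 v hv with h' | h' <;> grind
    intro u hu v hv
    by_cases huv : u = v
    · subst huv; simp
    · rw [e1 u hu v hv huv, e2 u hu v hv huv]
  rcases U.eq_empty_or_nonempty with rfl | ⟨w, hw⟩
  · simp
  by_cases hwt : w ∈ t.1 ↔ w ∈ t'.1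
  · left
    ext u
    have := same u
    simp only [mem_inter]
    grind
  · right
    ext u
    have := same u
    simp only [mem_inter]
    grind

lemma mem_union_of_mem_support {t : Finset (Fin n) × Finset (Fin n) × Fin n} {a : Fin n}
    (ha : a ∈ tripleSupport t) (hne : a ≠ t.2.2) : a ∈ t.1 ∪ t.2.1 :=
  (mem_insert.1 ha).resolve_left hne

lemma triple_eq {k : ℕ} {t : Finset (Fin n) × Finset (Fin n) × Fin n} (ht : t ∈ triples n k) :
    t = (t.1, ((tripleSupport t).erase t.2.2) \ t.1, t.2.2) := by
  rw [← triple_snd_eq ht]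

open Classical in
lemma card_compatible_support_eq_le {k s : ℕ} {t : Finset (Fin n) × Finset (Fin n) × Fin n}
    {W : Finset (Fin n)} (hs : #(tripleSupport t ∩ W) = s) (hW : #W = 2 * k + 1) :
    #{t' ∈ triples n k | CompatibleTriples t t' ∧ tripleSupport t' = W} ≤
      (2 * k + 1) * (2 * 2 ^ (2 * k + 1 - s + 1)) := by
  set D : Finset (Fin n × Bool × Finset (Fin n)) :=
    W ×ˢ (univ : Finset Bool) ×ˢ (insert t.2.2 (W \ tripleSupport t)).powerset with hD
  set U : Fin n → Finset (Fin n) := fun x => ((tripleSupport t ∩ W).erase t.2.2).erase x with hU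
  set X : Fin n × Bool × Finset (Fin n) → Finset (Fin n) := fun p =>
    (U p.1 ∩ if p.2.1 then t.1 else t.2.1) ∪ p.2.2 with hX
  have hcard : #D ≤ (2 * k + 1) * (2 * 2 ^ (2 * k + 1 - s + 1)) := by
    rw [hD, card_product, card_product, card_powerset, hW, card_univ, Fintype.card_bool]
    gcongr
    · norm_num
    · refine (card_insert_le _ _).trans ?_
      rw [card_sdiff, hW, hs]
  refine le_trans ?_ (card_image_le.trans hcard :
    #(D.image fun p => (X p, (W.erase p.1) \ X p, p.1)) ≤ _)
  refine card_le_card fun t' ht' => ?_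
  obtain ⟨ht1, hc, rfl⟩ := mem_filter.1 ht'
  have hUt : U t'.2.2 ⊆ t.1 ∪ t.2.1 := by
    intro a ha
    simp only [hU, mem_erase, mem_inter] at ha
    exact mem_union_of_mem_support ha.2.2.1 ha.2.1
  have hUt' : U t'.2.2 ⊆ t'.1 ∪ t'.2.1 := by
    intro a ha
    simp only [hU, mem_erase, mem_inter] at ha
    exact mem_union_of_mem_support ha.2.2.2 ha.1
  obtain ⟨b, hb⟩ : ∃ b : Bool, U t'.2.2 ∩ t'.1 = U t'.2.2 ∩ if b then t.1 else t.2.1 := by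
    rcases hc.fst_inter hUt hUt' with h | h
    · exact ⟨true, by simpa using h⟩
    · exact ⟨false, by simpa using h⟩
  have hXt : X (t'.2.2, b, t'.1 \ U t'.2.2) = t'.1 := by
    simp only [hX, ← hb]
    rw [inter_comm, union_comm, sdiff_union_inter]
  refine mem_image.2 ⟨(t'.2.2, b, t'.1 \ U t'.2.2), ?_, ?_⟩
  · refine mem_product.2 ⟨snd_mem_tripleSupport t', mem_product.2 ⟨mem_univ _,
      mem_powerset.2 fun a ha => ?_⟩⟩
    obtain ⟨ha1, ha2⟩ := mem_sdiff.1 ha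
    have h1 := mem_erase.1 (fst_subset_erase ht1 ha1)
    simp only [hU, mem_erase, mem_inter] at ha2
    simp only [mem_insert, Finset.mem_sdiff]
    tauto
  · simp only [hXt]
    exact (triple_eq ht1).symm

lemma CompatibleTriples.eq_or_swap {k : ℕ}
    {t t' : Finset (Fin n) × Finset (Fin n) × Fin n} (ht : t ∈ triples n k)
    (ht' : t' ∈ triples n k) (h : CompatibleTriples t t')
    (hs : tripleSupport t' = tripleSupport t) : t' = t ∨ t' = (t.2.1, t.1, t.2.2) := by
  have hx : t'.2.2 = t.2.2 := by
    obtain ⟨G, ⟨⟨a, ha⟩, ⟨b, hb⟩, -, -, -, -, -, a8, -, -, -⟩,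
      ⟨-, -, -, -, -, -, -, -, b9, b10, -⟩⟩ := h
    by_contra hne
    have hadj : ∀ v ∈ tripleSupport t, v ≠ t'.2.2 → G.Adj t'.2.2 v := by
      intro v hv hv'
      rw [← hs] at hv
      rcases mem_union.1 (mem_union_of_mem_support hv hv') with h | h
      · exact b9 v h
      · exact b10 v h
    have hdisj := (mem_triples.1 ht).2.2.1
    have hmem : t'.2.2 ∈ tripleSupport t := hs ▸ snd_mem_tripleSupport t'
    rcases mem_union.1 (mem_union_of_mem_support hmem hne) with h | h
    · exact a8 _ h b hb (hadj b (snd_subset_tripleSupport t hb)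
        fun hbe => Finset.disjoint_left.1 hdisj h (hbe ▸ hb))
    · exact a8 a ha _ h (hadj a (fst_subset_tripleSupport t ha)
        fun hae => Finset.disjoint_left.1 hdisj (hae ▸ ha) h).symm
  have hU : ∀ {r : Finset (Fin n) × Finset (Fin n) × Fin n},
      (tripleSupport r).erase r.2.2 ⊆ r.1 ∪ r.2.1 := by
    intro r a ha
    exact mem_union_of_mem_support (mem_erase.1 ha).2 (mem_erase.1 ha).1
  have hsub : (tripleSupport t).erase t.2.2 ⊆ t'.1 ∪ t'.2.1 := by
    rw [← hs, ← hx]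
    exact hU
  have key := h.fst_inter (hU (r := t)) hsub
  have h1 : t'.1 ⊆ (tripleSupport t).erase t.2.2 := by
    rw [← hs, ← hx]
    exact fst_subset_erase ht'
  have h3 : t.2.1 ⊆ (tripleSupport t).erase t.2.2 := by
    rw [triple_snd_eq ht]
    exact sdiff_subset
  rw [inter_eq_right.2 h1, inter_eq_right.2 (fst_subset_erase ht), inter_eq_right.2 h3] at key
  rcases key with key | key
  · left
    rw [triple_eq ht', triple_eq ht, hs, hx, key]
  · right
    rw [triple_eq ht', hs, hx, key]
    congr 2
    rw [triple_snd_eq ht, Finset.sdiff_sdiff_eq_self (fst_subset_erase ht)]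

open Classical in
lemma card_compatible_same_support_le {k : ℕ}
    {t : Finset (Fin n) × Finset (Fin n) × Fin n} (ht : t ∈ triples n k) :
    #{t' ∈ triples n k | #(tripleSupport t ∩ tripleSupport t') = 2 * k + 1 ∧
      CompatibleTriples t t'} ≤ 2 := by
  refine (card_le_card fun t' ht' => ?_).trans (card_le_two (a := t) (b := (t.2.1, t.1, t.2.2)))
  obtain ⟨ht1, hs, hc⟩ := mem_filter.1 ht'
  have h1 : tripleSupport t ∩ tripleSupport t' = tripleSupport t :=
    eq_of_subset_of_card_le inter_subset_left (by rw [hs, card_tripleSupport ht])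
  have h2 : tripleSupport t ∩ tripleSupport t' = tripleSupport t' :=
    eq_of_subset_of_card_le inter_subset_right (by rw [hs, card_tripleSupport ht1])
  simpa using hc.eq_or_swap ht ht1 (h2.symm.trans h1)

end Counting

section SecondMoment

variable {n : ℕ}

lemma unifProb_eq_graphProb (n : ℕ) (Q : SimpleGraph (Fin n) → Prop) :
    unifProb n Q = graphProb Q := by
  classical
  rw [unifProb, graphProb, card_simpleGraph_eq, Fintype.card_fin, Nat.card_eq_fintype_card,
    Fintype.card_subtype, card_filter]
  push_cast
  congr 1

lemma Xcount_pos_iff (n k : ℕ) (G : SimpleGraph (Fin n)) :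
    0 < Xcount n k k G ↔ ∃ t ∈ triples n k, IsConfigTriple t G := by
  rw [Xcount, Nat.card_pos_iff]
  constructor
  · rintro ⟨⟨t, h1, h2, h3⟩, -⟩
    exact ⟨t, mem_triples.2 ⟨h1, h2, h3.2.2.1, h3.2.2.2.1, h3.2.2.2.2.1⟩, h3⟩
  · rintro ⟨t, ht, h⟩
    exact ⟨⟨⟨t, (mem_triples.1 ht).1, (mem_triples.1 ht).2.1, h⟩⟩, inferInstance⟩

/-- The second moment method for a finite family of events. -/
lemma sq_sum_graphProb_le {V ι : Type*} [Fintype V] [DecidableEq V] (T : Finset ι)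
    (A : ι → SimpleGraph V → Prop) :
    (∑ t ∈ T, graphProb (A t)) ^ 2 ≤ graphProb (fun G => ∃ t ∈ T, A t G) *
      ∑ t ∈ T, ∑ t' ∈ T, graphProb (fun G => A t G ∧ A t' G) := by
  set X : SimpleGraph V → ℝ := fun G => ∑ t ∈ T, propInd (A t G) with hX
  have hpos := card_simpleGraph_pos (V := V)
  have h1 : ∑ t ∈ T, graphProb (A t) =
      (∑ G, propInd (∃ t ∈ T, A t G) * X G) / Fintype.card (SimpleGraph V) := by
    simp only [graphProb]
    rw [← sum_div, sum_comm]
    congr 1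
    refine sum_congr rfl fun G _ => ?_
    by_cases h : ∃ t ∈ T, A t G
    · rw [propInd_of_true h, one_mul]
    · rw [propInd_of_false h, zero_mul]
      exact sum_eq_zero fun t ht => propInd_of_false fun h' => h ⟨t, ht, h'⟩
  have h2 : ∑ t ∈ T, ∑ t' ∈ T, graphProb (fun G => A t G ∧ A t' G) =
      (∑ G, X G ^ 2) / Fintype.card (SimpleGraph V) := by
    simp only [graphProb, ← sum_div, propInd_and]
    congr 1
    simp only [hX, sq, sum_mul_sum]
    symm
    rw [sum_comm]
    exact sum_congr rfl fun t _ => sum_comm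
  have h3 : graphProb (fun G => ∃ t ∈ T, A t G) =
      (∑ G, propInd (∃ t ∈ T, A t G) ^ 2) / Fintype.card (SimpleGraph V) := by
    rw [graphProb]
    congr 1
    refine sum_congr rfl fun G _ => ?_
    rw [sq, ← propInd_and, and_self]
  rw [h1, h2, h3, div_pow, div_mul_div_comm, ← sq]
  gcongr
  exact sum_mul_sq_le_sq_mul_sq _ _ _

lemma choose_sub_le {n m s : ℕ} (hs : s ≤ m) (hmn : m < n) :
    (n.choose (m - s) : ℝ) ≤ n.choose m * (m / (n - m)) ^ s := by
  have hpos : (0 : ℝ) < n - m := by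
    have : (m : ℝ) < n := by exact_mod_cast hmn
    linarith
  induction s with
  | zero => simp
  | succ s ih =>
    refine le_trans ?_ (mul_le_mul_of_nonneg_right (ih (by omega))
      (by positivity : (0 : ℝ) ≤ m / (n - m)) |>.trans_eq (by rw [pow_succ]; ring))
    obtain ⟨j, hj⟩ : ∃ j, m - s = j + 1 := ⟨m - s - 1, by omega⟩
    have hj' : m - (s + 1) = j := by omega
    rw [hj, hj', mul_div_assoc', le_div_iff₀ hpos]
    have h := Nat.choose_succ_right_eq n j
    have h' : (n.choose (j + 1) : ℝ) * (j + 1) = n.choose j * (n - j) := by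
      have : ((n - j : ℕ) : ℝ) = n - j := by rw [Nat.cast_sub (by omega)]
      rw [← this]
      exact_mod_cast h
    have hjm : (j : ℝ) + 1 ≤ m := by
      have : j + 1 ≤ m := by omega
      exact_mod_cast this
    calc (n.choose j : ℝ) * (n - m) ≤ n.choose j * (n - j) := by gcongr; omega
      _ = n.choose (j + 1) * (j + 1) := h'.symm
      _ ≤ _ := by gcongr

lemma card_triples_inter_eq_le {k s : ℕ} (hs : s ≤ 2 * k + 1) (hn : 2 * k + 1 < n)
    {W : Finset (Fin n)} (hW : #W = 2 * k + 1) :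
    (#{t ∈ triples n k | #(W ∩ tripleSupport t) = s} : ℝ) ≤
      #(triples n k) * ((2 * k + 1) ^ 2 / (n - (2 * k + 1))) ^ s := by
  have h1 := card_triples_filter_inter_le (s := s) hW (fun _ => True)
    (c := (2 * k + 1) * (2 * k).choose k) (fun W' _ hW' => by
      simpa using (card_triples_support_eq hW').le)
  simp only [and_true] at h1
  have h2 : ((n - (2 * k + 1)).choose (2 * k + 1 - s) : ℝ) ≤ n.choose (2 * k + 1 - s) := by
    exact_mod_cast Nat.choose_le_choose _ (Nat.sub_le _ _)
  have h3 := choose_sub_le hs hn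
  have h4 : ((2 * k + 1).choose s : ℝ) ≤ ((2 * k + 1 : ℕ) : ℝ) ^ s := by
    exact_mod_cast Nat.choose_le_pow _ _
  have hpos : (0 : ℝ) < n - ((2 * k + 1 : ℕ) : ℝ) := by
    have : ((2 * k + 1 : ℕ) : ℝ) < n := by exact_mod_cast hn
    linarith
  calc (#{t ∈ triples n k | #(W ∩ tripleSupport t) = s} : ℝ)
      ≤ ((2 * k + 1) * (2 * k).choose k : ℕ) * (((2 * k + 1).choose s : ℝ) *
          (n - (2 * k + 1)).choose (2 * k + 1 - s)) := by exact_mod_cast h1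
    _ ≤ ((2 * k + 1) * (2 * k).choose k : ℕ) * (((2 * k + 1 : ℕ) : ℝ) ^ s *
          (n.choose (2 * k + 1) *
            (((2 * k + 1 : ℕ) : ℝ) / (n - ((2 * k + 1 : ℕ) : ℝ))) ^ s)) := by
        gcongr
        exact h2.trans h3
    _ = _ := by
        rw [card_triples, sq, mul_div_assoc, mul_pow]
        push_cast
        ring

open Classical in
lemma card_compatible_inter_eq_le {k s : ℕ} (hs : s ≤ 2 * k + 1)
    {t : Finset (Fin n) × Finset (Fin n) × Fin n} (ht : t ∈ triples n k) :
    #{t' ∈ triples n k | #(tripleSupport t ∩ tripleSupport t') = s ∧ CompatibleTriples t t'} ≤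
      4 * (2 * k + 1) * (2 * (2 * k + 1) * n) ^ (2 * k + 1 - s) := by
  have h1 := card_triples_filter_inter_le (s := s) (card_tripleSupport ht) (CompatibleTriples t)
    (fun W' h hW' => card_compatible_support_eq_le h hW')
  refine h1.trans ?_
  rw [← Nat.choose_symm hs]
  calc _ ≤ (2 * k + 1) * (2 * 2 ^ (2 * k + 1 - s + 1)) *
      ((2 * k + 1) ^ (2 * k + 1 - s) * n ^ (2 * k + 1 - s)) := by
        gcongr
        · exact Nat.choose_le_pow _ _
        · exact (Nat.choose_le_choose _ (Nat.sub_le _ _)).trans (Nat.choose_le_pow _ _)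
    _ = _ := by rw [mul_pow, mul_pow, pow_succ]; ring

end SecondMoment

section Estimates

lemma pow_sub_le_exp {q a c : ℝ} (hq : 0 ≤ q) (ha : 0 ≤ a) (hc : 0 ≤ c)
    (h : q ≤ Real.exp (-a + c)) (n p : ℕ) :
    q ^ (n - p) ≤ Real.exp (-(a * n) + a * p + c * n) := by
  refine (pow_le_pow_left₀ hq h _).trans ?_
  rw [← Real.exp_nat_mul, Real.exp_le_exp]
  have h1 : (n : ℝ) ≤ (n - p : ℕ) + p := by exact_mod_cast Nat.sub_le_iff_le_add.1 le_rfl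
  have h2 : ((n - p : ℕ) : ℝ) ≤ n := by exact_mod_cast Nat.sub_le _ _
  nlinarith [mul_le_mul_of_nonneg_left h1 ha, mul_le_mul_of_nonneg_left h2 hc]

lemma half_pow_mul_cast (k : ℕ) : (1 / 2 : ℝ) ^ k * ((2 ^ k * k : ℕ) : ℝ) = k := by
  push_cast
  rw [← mul_assoc, ← mul_pow]
  norm_num

lemma sq_sqrt_half : √(1 / 2) ^ 2 = 1 / 2 := Real.sq_sqrt (by norm_num)

lemma sqrt_half_le_one : √(1 / 2) ≤ 1 := by
  rw [Real.sqrt_le_left (by norm_num)]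
  norm_num

lemma choose_two_cast (s : ℕ) : 2 * (s.choose 2 : ℤ) = s * (s - 1) := by
  cases s with
  | zero => simp
  | succ s =>
    have := Nat.choose_succ_right_eq (s + 1) 1
    rw [Nat.choose_one_right, Nat.add_sub_cancel] at this
    zify at this
    push_cast
    linarith

lemma half_pow_mul_pow_le {k s C : ℕ} (hs : s ≤ k) (hC : s.choose 2 ≤ C) :
    (1 / 2 : ℝ) ^ (C - s.choose 2) * ((1 / 2) ^ k) ^ s ≤ (1 / 2) ^ C * (√(1 / 2) ^ k) ^ s := by
  have hh : (1 / 2 : ℝ) = √(1 / 2) ^ 2 := sq_sqrt_half.symm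
  have e1 : (1 / 2 : ℝ) ^ (C - s.choose 2) * ((1 / 2) ^ k) ^ s =
      √(1 / 2) ^ (2 * (C - s.choose 2) + 2 * k * s) := by
    rw [pow_add, pow_mul, sq_sqrt_half, mul_assoc, pow_mul, sq_sqrt_half, pow_mul]
  have e2 : (1 / 2 : ℝ) ^ C * (√(1 / 2) ^ k) ^ s = √(1 / 2) ^ (2 * C + k * s) := by
    rw [pow_add, pow_mul, sq_sqrt_half, pow_mul]
  rw [e1, e2]
  refine pow_le_pow_of_le_one (Real.sqrt_nonneg _) sqrt_half_le_one ?_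
  have h := choose_two_cast s
  zify [hC]
  have : (s : ℤ) ≤ k := by exact_mod_cast hs
  nlinarith

lemma half_pow_mul_two_pow_le {k j : ℕ} (hj : j ≤ k) :
    (1 / 2 : ℝ) ^ (2 * (2 * k + 1).choose 2 - (2 * k + 1 - j).choose 2) * (2 ^ k) ^ j ≤
      (1 / 2) ^ (2 * k + 1).choose 2 * (√(1 / 2) ^ k) ^ j := by
  have hc : (2 * k + 1 - j).choose 2 ≤ (2 * k + 1).choose 2 :=
    Nat.choose_le_choose _ (Nat.sub_le _ _)
  have e2 : (1 / 2 : ℝ) ^ (2 * k + 1).choose 2 * (√(1 / 2) ^ k) ^ j =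
      (√(1 / 2) ^ (2 * (2 * k + 1).choose 2 + k * j + 2 * (k * j))) * (2 ^ k) ^ j := by
    rw [pow_add, pow_mul _ 2 (k * j), sq_sqrt_half, mul_assoc, ← pow_mul 2 k j, ← mul_pow, pow_add,
      pow_mul, sq_sqrt_half, pow_mul]
    norm_num
  have e1 : (1 / 2 : ℝ) ^ (2 * (2 * k + 1).choose 2 - (2 * k + 1 - j).choose 2) =
      √(1 / 2) ^ (2 * (2 * (2 * k + 1).choose 2 - (2 * k + 1 - j).choose 2)) := by
    rw [pow_mul, sq_sqrt_half]
  rw [e2, e1]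
  gcongr ?_ * _
  refine pow_le_pow_of_le_one (Real.sqrt_nonneg _) sqrt_half_le_one ?_
  have h1 := choose_two_cast (2 * k + 1)
  have h2 := choose_two_cast (2 * k + 1 - j)
  have h3 : (2 * k + 1 - j).choose 2 ≤ 2 * (2 * k + 1).choose 2 := by omega
  have h4 : j ≤ 2 * k + 1 := by omega
  push_cast [h4] at h1 h2
  zify [h3]
  have : (j : ℤ) ≤ k := by exact_mod_cast hj
  have : (0 : ℤ) ≤ j := by positivity
  nlinarith

end Estimates

section PairBounds

lemma graphProb_isConfigTriple_and_le_small {k s : ℕ} (hk : 2 ≤ k)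
    {t t' : Finset (Fin (2 ^ k * k)) × Finset (Fin (2 ^ k * k)) × Fin (2 ^ k * k)}
    (ht : t ∈ triples (2 ^ k * k) k) (ht' : t' ∈ triples (2 ^ k * k) k)
    (hs : #(tripleSupport t ∩ tripleSupport t') = s) :
    graphProb (fun G => IsConfigTriple t G ∧ IsConfigTriple t' G) ≤
      (1 / 2) ^ (2 * (2 * k + 1).choose 2 - s.choose 2) *
        Real.exp (-(4 * k) + 8 * (1 / 2) ^ k * (2 * k + 1) + 6 * (2 ^ s * (k * (1 / 2) ^ k))) := by
  refine (graphProb_isConfigTriple_and_le (by omega) ht ht' hs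
    (fun y hy hy' => graphProb_hasNbr_four_le ht ht' hs hy hy')).trans ?_
  have hx : (1 / 2 : ℝ) ^ k ≤ 1 / 4 := by
    calc (1 / 2 : ℝ) ^ k ≤ (1 / 2) ^ 2 := pow_le_pow_of_le_one (by norm_num) (by norm_num) hk
      _ = 1 / 4 := by norm_num
  have hn := half_pow_mul_cast k
  set x : ℝ := (1 / 2) ^ k with hxdef
  have hx0 : 0 ≤ x := by positivity
  have hc : 0 ≤ 6 * (2 ^ s * x ^ 2) := by positivity
  gcongr
  refine (pow_sub_le_exp (a := 4 * x) (c := 6 * (2 ^ s * x ^ 2)) (by linarith) (by positivity) hc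
    ?_ _ _).trans ?_
  · linarith [Real.add_one_le_exp (-(4 * x) + 6 * (2 ^ s * x ^ 2))]
  · rw [Real.exp_le_exp]
    have h1 : ((2 * (2 * k + 1) - s : ℕ) : ℝ) ≤ 2 * (2 * k + 1) := by
      exact_mod_cast Nat.sub_le _ _
    have h2 : 4 * x * ((2 ^ k * k : ℕ) : ℝ) = 4 * k := by rw [mul_assoc, hn]
    have h3 : 6 * (2 ^ s * x ^ 2) * ((2 ^ k * k : ℕ) : ℝ) = 6 * (2 ^ s * (k * x)) := by
      rw [← hn]; ring
    rw [h2, h3]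
    nlinarith [mul_le_mul_of_nonneg_left h1 hx0]

lemma sq_one_sub_half_pow_pow_le (k p : ℕ) :
    ((1 - (1 / 2 : ℝ) ^ k) ^ 2) ^ (2 ^ k * k - p) ≤
      Real.exp (-(2 * k) + 2 * (1 / 2) ^ k * p) := by
  have hx : (1 / 2 : ℝ) ^ k ≤ 1 := pow_le_one₀ (by norm_num) (by norm_num)
  have hn := half_pow_mul_cast k
  set x : ℝ := (1 / 2) ^ k with hxdef
  have hx0 : 0 ≤ x := by positivity
  refine (pow_sub_le_exp (a := 2 * x) (c := 0) (by positivity) (by positivity) le_rfl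
    ?_ _ _).trans_eq ?_
  · rw [add_zero, show -(2 * x) = ((2 : ℕ) : ℝ) * (-x) by push_cast; ring, Real.exp_nat_mul]
    exact pow_le_pow_left₀ (by linarith) (by linarith [Real.add_one_le_exp (-x)]) 2
  · rw [mul_assoc, hn, zero_mul, add_zero]

lemma graphProb_isConfigTriple_and_le_large {k s : ℕ} (hk : 1 ≤ k)
    {t t' : Finset (Fin (2 ^ k * k)) × Finset (Fin (2 ^ k * k)) × Fin (2 ^ k * k)}
    (ht : t ∈ triples (2 ^ k * k) k) (ht' : t' ∈ triples (2 ^ k * k) k)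
    (hs : #(tripleSupport t ∩ tripleSupport t') = s) :
    graphProb (fun G => IsConfigTriple t G ∧ IsConfigTriple t' G) ≤
      (1 / 2) ^ (2 * (2 * k + 1).choose 2 - s.choose 2) *
        Real.exp (-(2 * k) + 4 * (1 / 2) ^ k * (2 * k + 1)) := by
  refine (graphProb_isConfigTriple_and_le hk ht ht' hs
    (fun y hy hy' => graphProb_hasNbr_four_le_sq ht hy)).trans ?_
  gcongr
  refine (sq_one_sub_half_pow_pow_le _ _).trans ?_
  rw [Real.exp_le_exp]
  have h1 : ((2 * (2 * k + 1) - s : ℕ) : ℝ) ≤ 2 * (2 * k + 1) := by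
    exact_mod_cast Nat.sub_le _ _
  nlinarith [mul_le_mul_of_nonneg_left h1 (by positivity : (0 : ℝ) ≤ (1 / 2) ^ k)]

lemma graphProb_isConfigTriple_le {k : ℕ} (hk : 1 ≤ k)
    {t : Finset (Fin (2 ^ k * k)) × Finset (Fin (2 ^ k * k)) × Fin (2 ^ k * k)}
    (ht : t ∈ triples (2 ^ k * k) k) :
    graphProb (IsConfigTriple t) ≤ (1 / 2) ^ (2 * k + 1).choose 2 *
      Real.exp (-(2 * k) + 2 * (1 / 2) ^ k * (2 * k + 1)) := by
  rw [graphProb_isConfigTriple hk ht]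
  gcongr
  simpa using sq_one_sub_half_pow_pow_le k (2 * k + 1)

lemma le_graphProb_isConfigTriple {k : ℕ} (hk : 1 ≤ k)
    {t : Finset (Fin (2 ^ k * k)) × Finset (Fin (2 ^ k * k)) × Fin (2 ^ k * k)}
    (ht : t ∈ triples (2 ^ k * k) k) :
    (1 / 2) ^ (2 * k + 1).choose 2 * Real.exp (-(2 * k) - 4 * (1 / 2) ^ k * k) ≤
      graphProb (IsConfigTriple t) := by
  rw [graphProb_isConfigTriple hk ht]
  gcongr
  have hx : (1 / 2 : ℝ) ^ k ≤ 1 / 2 := by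
    simpa using pow_le_pow_of_le_one (by norm_num : (0 : ℝ) ≤ 1 / 2) (by norm_num) hk
  have hn := half_pow_mul_cast k
  set x : ℝ := (1 / 2) ^ k with hxdef
  have hx0 : 0 ≤ x := by positivity
  have hx1 : 0 < 1 - x := by linarith
  have h1 : Real.exp (-(x + 2 * x ^ 2)) ≤ 1 - x := by
    rw [Real.exp_neg, inv_le_comm₀ (Real.exp_pos _) hx1]
    refine le_trans ?_ (Real.add_one_le_exp _)
    rw [inv_le_iff_one_le_mul₀ hx1]
    nlinarith [mul_nonneg hx0 hx0, mul_nonneg (mul_nonneg hx0 hx0) (by linarith : 0 ≤ 1 - 2 * x)]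
  calc Real.exp (-(2 * k) - 4 * x * k)
      = (Real.exp (-(x + 2 * x ^ 2)) ^ 2) ^ (2 ^ k * k) := by
        rw [← pow_mul, ← Real.exp_nat_mul]
        congr 1
        push_cast at hn ⊢
        linear_combination (2 + 4 * x) * hn
    _ ≤ ((1 - x) ^ 2) ^ (2 ^ k * k) := by gcongr
    _ ≤ _ := pow_le_pow_of_le_one (by positivity) (by nlinarith) (Nat.sub_le _ _)

end PairBounds

section SecondMomentBounds

/-- The leading order of the expected number of configurations for `n = 2 ^ k * k`. -/
noncomputable def tripleMean (k : ℕ) : ℝ :=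
  #(triples (2 ^ k * k) k) * (1 / 2) ^ (2 * k + 1).choose 2 * Real.exp (-(2 * k))

lemma tripleMean_nonneg (k : ℕ) : 0 ≤ tripleMean k := by
  unfold tripleMean
  positivity

lemma sum_graphProb_le {k : ℕ} (hk : 1 ≤ k) :
    tripleMean k * Real.exp (-4 * (1 / 2) ^ k * k) ≤
      ∑ t ∈ triples (2 ^ k * k) k, graphProb (IsConfigTriple t) := by
  refine le_trans (le_of_eq ?_) (card_nsmul_le_sum _ _ _ fun t ht =>
    le_graphProb_isConfigTriple hk ht)
  rw [nsmul_eq_mul, tripleMean, show -(2 * (k : ℝ)) - 4 * (1 / 2) ^ k * k =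
    -(2 * k) + -4 * (1 / 2) ^ k * k by ring, Real.exp_add]
  ring

lemma two_pow_mul_ge {k : ℕ} (hk : 3 ≤ k) : 2 * (2 * k + 1) ≤ 2 ^ k * k := by
  have h : 2 ^ 3 ≤ 2 ^ k := Nat.pow_le_pow_right (by norm_num) hk
  nlinarith

lemma sq_div_le {k : ℕ} (hk : 3 ≤ k) :
    (2 * k + 1 : ℝ) ^ 2 / (((2 ^ k * k : ℕ) : ℝ) - (2 * k + 1)) ≤ 18 * k * (1 / 2) ^ k := by
  have h1 : (2 * (2 * k + 1) : ℝ) ≤ ((2 ^ k * k : ℕ) : ℝ) := by exact_mod_cast two_pow_mul_ge hk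
  have hk' : (3 : ℝ) ≤ k := by exact_mod_cast hk
  rw [div_le_iff₀ (by linarith)]
  have hn := half_pow_mul_cast k
  have hx : (0 : ℝ) ≤ (1 / 2) ^ k := by positivity
  set x : ℝ := (1 / 2) ^ k
  set N : ℝ := ((2 ^ k * k : ℕ) : ℝ)
  have h2 : x * (N / 2) ≤ x * (N - (2 * k + 1)) := by
    gcongr
    linarith
  calc (2 * k + 1 : ℝ) ^ 2 ≤ 18 * k * (x * (N / 2)) := by
        rw [← mul_div_assoc, hn]; nlinarith
    _ ≤ 18 * k * (x * (N - (2 * k + 1))) := by gcongr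
    _ = _ := by ring

lemma mul_sum_small_le {k s : ℕ} (hk : 3 ≤ k) (hs : s ≤ k)
    {t : Finset (Fin (2 ^ k * k)) × Finset (Fin (2 ^ k * k)) × Fin (2 ^ k * k)}
    (ht : t ∈ triples (2 ^ k * k) k) :
    #(triples (2 ^ k * k) k) *
      ∑ t' ∈ triples (2 ^ k * k) k with #(tripleSupport t ∩ tripleSupport t') = s,
        graphProb (fun G => IsConfigTriple t G ∧ IsConfigTriple t' G) ≤
      tripleMean k ^ 2 * Real.exp (8 * (1 / 2) ^ k * (2 * k + 1)) *
        Real.exp (6 * (2 ^ s * (k * (1 / 2) ^ k))) * (18 * k * √(1 / 2) ^ k) ^ s := by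
  have hn : 2 * k + 1 < 2 ^ k * k := by have := two_pow_mul_ge hk; omega
  have h1 := sum_le_card_nsmul _ _ _ fun t' (ht' : t' ∈ {t' ∈ triples (2 ^ k * k) k |
      #(tripleSupport t ∩ tripleSupport t') = s}) =>
    graphProb_isConfigTriple_and_le_small (by omega) ht (mem_filter.1 ht').1 (mem_filter.1 ht').2
  have hpos : (0 : ℝ) ≤ ((2 ^ k * k : ℕ) : ℝ) - (2 * k + 1) := by
    have : ((2 * k + 1 : ℕ) : ℝ) < ((2 ^ k * k : ℕ) : ℝ) := by exact_mod_cast hn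
    push_cast at this ⊢
    linarith
  have h2 := (card_triples_inter_eq_le (s := s) (by omega) hn (card_tripleSupport ht)).trans
    (mul_le_mul_of_nonneg_left (pow_le_pow_left₀ (by positivity) (sq_div_le hk) s)
      (Nat.cast_nonneg _))
  have hC : s.choose 2 ≤ 2 * (2 * k + 1).choose 2 :=
    (Nat.choose_le_choose 2 (by omega : s ≤ 2 * k + 1)).trans (by omega)
  have h3 := half_pow_mul_pow_le hs hC
  rw [nsmul_eq_mul] at h1
  have hexp : Real.exp (-(4 * k) + 8 * (1 / 2) ^ k * (2 * k + 1) + 6 * (2 ^ s * (k * (1 / 2) ^ k)))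
      = Real.exp (-(2 * k)) ^ 2 * Real.exp (8 * (1 / 2) ^ k * (2 * k + 1)) *
        Real.exp (6 * (2 ^ s * (k * (1 / 2) ^ k))) := by
    rw [← Real.exp_nat_mul, ← Real.exp_add, ← Real.exp_add]
    congr 1
    push_cast
    ring
  rw [hexp] at h1
  set E1 := Real.exp (8 * (1 / 2) ^ k * (2 * k + 1))
  set E2 := Real.exp (6 * (2 ^ s * (k * (1 / 2) ^ k)))
  set M : ℝ := (#(triples (2 ^ k * k) k) : ℝ) with hM
  calc _ ≤ M * (M * (18 * k * (1 / 2) ^ k) ^ s *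
        ((1 / 2) ^ (2 * (2 * k + 1).choose 2 - s.choose 2) *
          (Real.exp (-(2 * k)) ^ 2 * E1 * E2))) := by
        gcongr
        exact h1.trans (by gcongr)
    _ = M ^ 2 * (18 * k) ^ s * ((1 / 2) ^ (2 * (2 * k + 1).choose 2 - s.choose 2) *
          ((1 / 2) ^ k) ^ s) * (Real.exp (-(2 * k)) ^ 2 * E1 * E2) := by
        rw [mul_pow]; ring
    _ ≤ M ^ 2 * (18 * k) ^ s * ((1 / 2) ^ (2 * (2 * k + 1).choose 2) * (√(1 / 2) ^ k) ^ s) *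
          (Real.exp (-(2 * k)) ^ 2 * E1 * E2) := by gcongr
    _ = _ := by rw [tripleMean, ← hM, mul_pow _ _ s, mul_comm 2 (_ : ℕ), pow_mul]; ring

lemma mul_two_pow_mul_half_pow_le {k s : ℕ} (h1 : 1 ≤ s) (hs : s ≤ k) :
    (2 : ℝ) ^ s * (k * (1 / 2) ^ k) ≤ s := by
  obtain ⟨d, rfl⟩ := Nat.exists_eq_add_of_le hs
  have h2 : s + d ≤ s * 2 ^ d := by
    have : d + 1 ≤ 2 ^ d := Nat.lt_two_pow_self
    nlinarith
  have h3 : ((s + d : ℕ) : ℝ) ≤ s * 2 ^ d := by exact_mod_cast h2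
  calc (2 : ℝ) ^ s * ((s + d : ℕ) * (1 / 2) ^ (s + d))
      ≤ (2 : ℝ) ^ s * (s * 2 ^ d * (1 / 2) ^ (s + d)) := by gcongr
    _ = s * ((2 * (1 / 2)) ^ s * (2 * (1 / 2)) ^ d) := by rw [mul_pow, mul_pow, pow_add]; ring
    _ = s := by norm_num

lemma mul_sum_zero_le {k : ℕ} (hk : 3 ≤ k)
    {t : Finset (Fin (2 ^ k * k)) × Finset (Fin (2 ^ k * k)) × Fin (2 ^ k * k)}
    (ht : t ∈ triples (2 ^ k * k) k) :
    #(triples (2 ^ k * k) k) *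
      ∑ t' ∈ triples (2 ^ k * k) k with #(tripleSupport t ∩ tripleSupport t') = 0,
        graphProb (fun G => IsConfigTriple t G ∧ IsConfigTriple t' G) ≤
      tripleMean k ^ 2 * Real.exp (8 * (1 / 2) ^ k * (2 * k + 1)) *
        Real.exp (6 * (k * (1 / 2) ^ k)) := by
  simpa using mul_sum_small_le hk (Nat.zero_le k) ht

lemma mul_sum_pos_le {k s : ℕ} (hk : 3 ≤ k) (hs1 : 1 ≤ s) (hs : s ≤ k)
    (hρ : 18 * k * Real.exp 6 * √(1 / 2) ^ k ≤ 1)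
    {t : Finset (Fin (2 ^ k * k)) × Finset (Fin (2 ^ k * k)) × Fin (2 ^ k * k)}
    (ht : t ∈ triples (2 ^ k * k) k) :
    #(triples (2 ^ k * k) k) *
      ∑ t' ∈ triples (2 ^ k * k) k with #(tripleSupport t ∩ tripleSupport t') = s,
        graphProb (fun G => IsConfigTriple t G ∧ IsConfigTriple t' G) ≤
      tripleMean k ^ 2 * Real.exp (8 * (1 / 2) ^ k * (2 * k + 1)) *
        (18 * k * Real.exp 6 * √(1 / 2) ^ k) := by
  refine (mul_sum_small_le hk hs ht).trans ?_
  rw [mul_assoc]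
  gcongr ?_ * ?_
  calc Real.exp (6 * (2 ^ s * (k * (1 / 2) ^ k))) * (18 * k * √(1 / 2) ^ k) ^ s
      ≤ Real.exp (s * 6) * (18 * k * √(1 / 2) ^ k) ^ s := by
        gcongr ?_ * _
        rw [Real.exp_le_exp]
        linarith [mul_two_pow_mul_half_pow_le hs1 hs]
    _ = (18 * k * Real.exp 6 * √(1 / 2) ^ k) ^ s := by
        rw [Real.exp_nat_mul, ← mul_pow]; congr 1; ring
    _ ≤ _ := pow_le_of_le_one (by positivity) hρ (by omega)

lemma sum_graphProb_le_card_compatible {n k s : ℕ} {c : ℝ}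
    {t : Finset (Fin n) × Finset (Fin n) × Fin n} {N : ℕ}
    (hN : open Classical in
      #{t' ∈ triples n k | #(tripleSupport t ∩ tripleSupport t') = s ∧ CompatibleTriples t t'} ≤ N)
    (hc0 : 0 ≤ c)
    (hc : ∀ t' ∈ triples n k, #(tripleSupport t ∩ tripleSupport t') = s →
      graphProb (fun G => IsConfigTriple t G ∧ IsConfigTriple t' G) ≤ c) :
    ∑ t' ∈ triples n k with #(tripleSupport t ∩ tripleSupport t') = s,
      graphProb (fun G => IsConfigTriple t G ∧ IsConfigTriple t' G) ≤ N * c := by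
  classical
  have h0 : ∑ t' ∈ {t' ∈ triples n k | #(tripleSupport t ∩ tripleSupport t') = s} with
      CompatibleTriples t t', graphProb (fun G => IsConfigTriple t G ∧ IsConfigTriple t' G) =
      ∑ t' ∈ triples n k with #(tripleSupport t ∩ tripleSupport t') = s,
      graphProb (fun G => IsConfigTriple t G ∧ IsConfigTriple t' G) := by
    refine sum_filter_of_ne fun t' _ hne => ?_
    by_contra h
    exact hne (graphProb_false fun G hG => h ⟨G, hG⟩)
  rw [← h0, filter_filter]
  refine (sum_le_card_nsmul _ _ c fun t' ht' => ?_).trans ?_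
  · obtain ⟨h1, h2, -⟩ := mem_filter.1 ht'
    exact hc t' h1 h2
  · rw [nsmul_eq_mul]
    gcongr

lemma mul_sum_large_le {k j : ℕ} (hk : 1 ≤ k) (hj1 : 1 ≤ j) (hj : j ≤ k)
    (hρ : 2 * (2 * k + 1) * k * √(1 / 2) ^ k ≤ 1)
    {t : Finset (Fin (2 ^ k * k)) × Finset (Fin (2 ^ k * k)) × Fin (2 ^ k * k)}
    (ht : t ∈ triples (2 ^ k * k) k) :
    #(triples (2 ^ k * k) k) *
      ∑ t' ∈ triples (2 ^ k * k) k with #(tripleSupport t ∩ tripleSupport t') = 2 * k + 1 - j,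
        graphProb (fun G => IsConfigTriple t G ∧ IsConfigTriple t' G) ≤
      tripleMean k * Real.exp (4 * (1 / 2) ^ k * (2 * k + 1)) *
        (4 * (2 * k + 1) * (2 * (2 * k + 1) * k * √(1 / 2) ^ k)) := by
  have h1 := sum_graphProb_le_card_compatible (c := (1 / 2) ^ (2 * (2 * k + 1).choose 2 -
      (2 * k + 1 - j).choose 2) * Real.exp (-(2 * k) + 4 * (1 / 2) ^ k * (2 * k + 1)))
    (card_compatible_inter_eq_le (Nat.sub_le _ j) ht) (by positivity)
    (fun t' ht' hs => graphProb_isConfigTriple_and_le_large hk ht ht' hs)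
  rw [Nat.sub_sub_self (by omega : j ≤ 2 * k + 1), Real.exp_add] at h1
  push_cast at h1
  have h3 := half_pow_mul_two_pow_le hj
  set E1 := Real.exp (4 * (1 / 2) ^ k * (2 * k + 1))
  set M : ℝ := (#(triples (2 ^ k * k) k) : ℝ) with hM
  refine (mul_le_mul_of_nonneg_left h1 (Nat.cast_nonneg _)).trans ?_
  calc M * (4 * (2 * k + 1) * (2 * (2 * k + 1) * (2 ^ k * k)) ^ j *
        ((1 / 2) ^ (2 * (2 * k + 1).choose 2 - (2 * k + 1 - j).choose 2) *
          (Real.exp (-(2 * k)) * E1)))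
      = M * (4 * (2 * k + 1) * (2 * (2 * k + 1) * k) ^ j *
        ((1 / 2) ^ (2 * (2 * k + 1).choose 2 - (2 * k + 1 - j).choose 2) * (2 ^ k) ^ j) *
          (Real.exp (-(2 * k)) * E1)) := by
        rw [show (2 * (2 * k + 1) * (2 ^ k * k) : ℝ) = 2 * (2 * k + 1) * k * 2 ^ k by ring,
          mul_pow _ ((2 : ℝ) ^ k)]
        ring
    _ ≤ M * (4 * (2 * k + 1) * (2 * (2 * k + 1) * k) ^ j *
        ((1 / 2) ^ (2 * k + 1).choose 2 * (√(1 / 2) ^ k) ^ j) *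
          (Real.exp (-(2 * k)) * E1)) := by gcongr
    _ = tripleMean k * E1 * (4 * (2 * k + 1) * (2 * (2 * k + 1) * k * √(1 / 2) ^ k) ^ j) := by
        rw [tripleMean, ← hM, mul_pow _ (√(1 / 2) ^ k)]; ring
    _ ≤ _ := by
        have := tripleMean_nonneg k
        gcongr
        exact pow_le_of_le_one (by positivity) hρ (by omega)

lemma mul_sum_top_le {k : ℕ} (hk : 1 ≤ k)
    {t : Finset (Fin (2 ^ k * k)) × Finset (Fin (2 ^ k * k)) × Fin (2 ^ k * k)}
    (ht : t ∈ triples (2 ^ k * k) k) :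
    #(triples (2 ^ k * k) k) *
      ∑ t' ∈ triples (2 ^ k * k) k with #(tripleSupport t ∩ tripleSupport t') = 2 * k + 1,
        graphProb (fun G => IsConfigTriple t G ∧ IsConfigTriple t' G) ≤
      2 * (tripleMean k * Real.exp (2 * (1 / 2) ^ k * (2 * k + 1))) := by
  have h1 := sum_graphProb_le_card_compatible (card_compatible_same_support_le ht)
    (c := (1 / 2) ^ (2 * k + 1).choose 2 * Real.exp (-(2 * k) + 2 * (1 / 2) ^ k * (2 * k + 1)))
    (by positivity)
    (fun t' ht' hs => (graphProb_mono fun G hG => hG.1).trans (graphProb_isConfigTriple_le hk ht))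
  refine (mul_le_mul_of_nonneg_left h1 (Nat.cast_nonneg _)).trans_eq ?_
  rw [tripleMean, Real.exp_add]
  push_cast
  ring

/-- An upper bound for the second moment of the number of configurations. -/
noncomputable def secondMomentBound (k : ℕ) : ℝ :=
  tripleMean k ^ 2 * Real.exp (8 * (1 / 2) ^ k * (2 * k + 1)) * Real.exp (6 * (k * (1 / 2) ^ k)) +
  k * (tripleMean k ^ 2 * Real.exp (8 * (1 / 2) ^ k * (2 * k + 1)) *
    (18 * k * Real.exp 6 * √(1 / 2) ^ k)) +
  k * (tripleMean k * Real.exp (4 * (1 / 2) ^ k * (2 * k + 1)) *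
    (4 * (2 * k + 1) * (2 * (2 * k + 1) * k * √(1 / 2) ^ k))) +
  2 * (tripleMean k * Real.exp (2 * (1 / 2) ^ k * (2 * k + 1)))

lemma sum_sum_graphProb_le {k : ℕ} (hk : 3 ≤ k)
    (hρ : 18 * k * Real.exp 6 * √(1 / 2) ^ k ≤ 1)
    (hρ' : 2 * (2 * k + 1) * k * √(1 / 2) ^ k ≤ 1) :
    ∑ t ∈ triples (2 ^ k * k) k, ∑ t' ∈ triples (2 ^ k * k) k,
      graphProb (fun G => IsConfigTriple t G ∧ IsConfigTriple t' G) ≤ secondMomentBound k := by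
  have hM : ∀ t ∈ triples (2 ^ k * k) k, #(triples (2 ^ k * k) k) *
      ∑ t' ∈ triples (2 ^ k * k) k,
        graphProb (fun G => IsConfigTriple t G ∧ IsConfigTriple t' G) ≤ secondMomentBound k := by
    intro t ht
    rw [← sum_fiberwise_of_maps_to (g := fun t' => #(tripleSupport t ∩ tripleSupport t'))
      (t := range (k + k + 1 + 1)) (fun t' _ => mem_range.2 ?_), mul_sum, sum_range_succ,
      sum_range_succ', sum_range_add]
    · have e1 := sum_le_card_nsmul (range k) _ _ fun i hi =>
        mul_sum_pos_le hk (Nat.le_add_left 1 i) (mem_range.1 hi) hρ ht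
      have e2 := sum_le_card_nsmul (range k) (fun i => #(triples (2 ^ k * k) k) *
          ∑ t' ∈ triples (2 ^ k * k) k with
            #(tripleSupport t ∩ tripleSupport t') = k + i + 1,
          graphProb (fun G => IsConfigTriple t G ∧ IsConfigTriple t' G)) _ fun i hi => by
        have hi' := mem_range.1 hi
        have := mul_sum_large_le (j := k - i) (by omega) (by omega) (by omega) hρ' ht
        rwa [show 2 * k + 1 - (k - i) = k + i + 1 by omega] at this
      have e3 := mul_sum_zero_le hk ht
      have e4 := mul_sum_top_le (by omega) ht
      rw [card_range, nsmul_eq_mul] at e1 e2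
      rw [two_mul k] at e4
      rw [secondMomentBound]
      linarith
    · have := card_le_card (inter_subset_left (s₁ := tripleSupport t) (s₂ := tripleSupport t'))
      rw [card_tripleSupport ht] at this
      omega
  rcases Nat.eq_zero_or_pos #(triples (2 ^ k * k) k) with h0 | h0
  · have := tripleMean_nonneg k
    rw [card_eq_zero.1 h0, sum_empty, secondMomentBound]
    positivity
  · have h := sum_le_card_nsmul _ _ _ hM
    rw [nsmul_eq_mul, ← mul_sum] at h
    exact le_of_mul_le_mul_left h (by exact_mod_cast h0)

lemma sq_le_unifProb_mul {k : ℕ} (hk : 3 ≤ k)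
    (hρ : 18 * k * Real.exp 6 * √(1 / 2) ^ k ≤ 1)
    (hρ' : 2 * (2 * k + 1) * k * √(1 / 2) ^ k ≤ 1) :
    (tripleMean k * Real.exp (-4 * (1 / 2) ^ k * k)) ^ 2 ≤
      unifProb (2 ^ k * k) (fun G => 0 < Xcount (2 ^ k * k) k k G) * secondMomentBound k := by
  have h := tripleMean_nonneg k
  simp only [unifProb_eq_graphProb, Xcount_pos_iff]
  calc _ ≤ (∑ t ∈ triples (2 ^ k * k) k, graphProb (IsConfigTriple t)) ^ 2 := by
        gcongr
        exact sum_graphProb_le (by omega)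
    _ ≤ _ := sq_sum_graphProb_le _ _
    _ ≤ _ := mul_le_mul_of_nonneg_left (sum_sum_graphProb_le hk hρ hρ') (graphProb_nonneg _)

end SecondMomentBounds

section Limits

lemma tendsto_descFactorial_div :
    Tendsto (fun k : ℕ => ((2 ^ k * k).descFactorial (2 * k + 1) : ℝ) /
      ((2 ^ k * k : ℕ) : ℝ) ^ (2 * k + 1)) atTop (nhds 1) := by
  have h0 : Tendsto (fun k : ℕ => 1 - 9 * ((k : ℝ) ^ 1 * (1 / 2) ^ k)) atTop (nhds 1) := by
    simpa using ((tendsto_pow_const_mul_const_pow_of_lt_one 1 (r := (1 / 2 : ℝ)) (by norm_num)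
      (by norm_num)).const_mul 9).const_sub 1
  refine tendsto_of_tendsto_of_tendsto_of_le_of_le' h0 tendsto_const_nhds ?_ ?_
  · filter_upwards [eventually_ge_atTop 3] with k hk
    have hn := two_pow_mul_ge hk
    have hx := half_pow_mul_cast k
    have hd := Nat.pow_sub_le_descFactorial (2 ^ k * k) (2 * k + 1)
    set n := 2 ^ k * k with hndef
    have hn0 : (0 : ℝ) < n := by
      have : 0 < n := by omega
      exact_mod_cast this
    have hd' : ((n : ℝ) - 2 * k) ^ (2 * k + 1) ≤ (n.descFactorial (2 * k + 1) : ℝ) := by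
      have e : ((n + 1 - (2 * k + 1) : ℕ) : ℝ) = n - 2 * k := by
        rw [Nat.add_sub_add_right, Nat.cast_sub (by omega)]
        push_cast
        rfl
      rw [← e]
      exact_mod_cast hd
    have hk' : (3 : ℝ) ≤ k := by exact_mod_cast hk
    have hxk : (1 / 2 : ℝ) ^ k = k / n := by rw [eq_div_iff hn0.ne', hx]
    have hb := one_add_mul_le_pow (a := -(2 * k / n : ℝ)) (by
      have : (2 * k : ℝ) / n ≤ 2 := by
        rw [div_le_iff₀ hn0]
        have : ((2 * k : ℕ) : ℝ) ≤ (2 * n : ℕ) := by exact_mod_cast (by omega)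
        push_cast at this
        exact this
      linarith) (2 * k + 1)
    rw [le_div_iff₀ (by positivity)]
    refine le_trans ?_ hd'
    have e2 : (n : ℝ) - 2 * k = (1 + -(2 * k / n)) * n := by field_simp; ring
    rw [e2, mul_pow]
    gcongr
    refine le_trans ?_ hb
    rw [hxk, pow_one]
    have : 9 * (k * (k / n) : ℝ) - ((2 * k + 1 : ℕ) : ℝ) * (2 * k / n) =
        (9 * k ^ 2 - (2 * k + 1) * (2 * k)) / n := by push_cast; field_simp
    have h2 : (0 : ℝ) ≤ (9 * k ^ 2 - (2 * k + 1) * (2 * k)) / n :=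
      div_nonneg (by nlinarith) hn0.le
    linarith
  · refine Eventually.of_forall fun k => div_le_one_of_le₀ ?_ (by positivity)
    exact_mod_cast Nat.descFactorial_le_pow _ _

lemma tripleMean_eq {k : ℕ} (hk : 1 ≤ k) :
    tripleMean k = ((2 ^ k * k).descFactorial (2 * k + 1) : ℝ) /
      ((2 ^ k * k : ℕ) : ℝ) ^ (2 * k + 1) * (2 * Stirling.stirlingSeq k ^ 2)⁻¹ := by
  have hk0 : (0 : ℝ) < k := by exact_mod_cast hk
  have h1 : #(triples (2 ^ k * k) k) * (k.factorial * k.factorial) =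
      (2 ^ k * k).descFactorial (2 * k + 1) := by
    have h := Nat.choose_mul_factorial_mul_factorial (Nat.le_add_left k k)
    rw [Nat.add_sub_cancel, ← two_mul] at h
    rw [card_triples, Nat.descFactorial_eq_factorial_mul_choose, Nat.factorial_succ, ← h]
    ring
  have h2 : (1 / 2 : ℝ) ^ (2 * k + 1).choose 2 * ((2 ^ k * k : ℕ) : ℝ) ^ (2 * k + 1) =
      k ^ (2 * k + 1) := by
    have : (2 * k + 1).choose 2 = k * (2 * k + 1) := by
      have := choose_two_cast (2 * k + 1)
      zify
      push_cast at this
      linarith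
    rw [this, pow_mul, ← mul_pow, half_pow_mul_cast]
  have hS : 2 * Stirling.stirlingSeq k ^ 2 =
      (k.factorial : ℝ) ^ 2 / (k * (k ^ (2 * k) * Real.exp (-(2 * k)))) := by
    rw [Stirling.stirlingSeq, div_pow, mul_pow, Real.sq_sqrt (by positivity), ← pow_mul, div_pow,
      ← Real.exp_nat_mul, Real.exp_neg]
    push_cast
    rw [mul_one, mul_comm (k : ℝ) 2, mul_comm k 2]
    field_simp
  have hn : ((2 ^ k * k : ℕ) : ℝ) ^ (2 * k + 1) ≠ 0 := by
    push_cast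
    positivity
  have hf : (k.factorial : ℝ) ≠ 0 := by positivity
  have h1' : (#(triples (2 ^ k * k) k) : ℝ) =
      ((2 ^ k * k).descFactorial (2 * k + 1) : ℝ) / (k.factorial : ℝ) ^ 2 := by
    rw [eq_div_iff (by positivity), ← h1]
    push_cast
    ring
  have h2' : (1 / 2 : ℝ) ^ (2 * k + 1).choose 2 =
      k * k ^ (2 * k) / ((2 ^ k * k : ℕ) : ℝ) ^ (2 * k + 1) := by
    rw [eq_div_iff hn, h2, pow_succ']
  rw [tripleMean, h1', h2', hS, inv_div]
  ring

lemma tendsto_tripleMean : Tendsto tripleMean atTop (nhds (1 / (2 * Real.pi))) := by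
  have hpi : (2 * √Real.pi ^ 2) ≠ 0 := by positivity
  have h := tendsto_descFactorial_div.mul
    (((Stirling.tendsto_stirlingSeq_sqrt_pi.pow 2).const_mul 2).inv₀ hpi)
  rw [Real.sq_sqrt Real.pi_pos.le, one_mul, ← one_div] at h
  refine h.congr' ?_
  filter_upwards [eventually_ge_atTop 1] with k hk
  exact (tripleMean_eq hk).symm

lemma tendsto_pow_mul_half_pow (p : ℕ) :
    Tendsto (fun k : ℕ => (k : ℝ) ^ p * (1 / 2) ^ k) atTop (nhds 0) :=
  tendsto_pow_const_mul_const_pow_of_lt_one p (by norm_num) (by norm_num)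

lemma tendsto_pow_mul_sqrt_half_pow (p : ℕ) :
    Tendsto (fun k : ℕ => (k : ℝ) ^ p * √(1 / 2) ^ k) atTop (nhds 0) :=
  tendsto_pow_const_mul_const_pow_of_lt_one p (Real.sqrt_nonneg _)
    (by rw [Real.sqrt_lt' one_pos]; norm_num)

lemma tendsto_exp_half_pow_mul (c : ℝ) :
    Tendsto (fun k : ℕ => Real.exp (c * (1 / 2) ^ k * (2 * k + 1))) atTop (nhds 1) := by
  have h : Tendsto (fun k : ℕ => c * (1 / 2 : ℝ) ^ k * (2 * k + 1)) atTop (nhds 0) := by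
    have := ((tendsto_pow_mul_half_pow 1).const_mul (2 * c)).add
      ((tendsto_pow_mul_half_pow 0).const_mul c)
    simp only [mul_zero, add_zero] at this
    exact this.congr fun k => by ring
  simpa [Function.comp_def] using (Real.continuous_exp.tendsto 0).comp h

lemma tendsto_secondMomentBound : Tendsto secondMomentBound atTop
    (nhds ((1 / (2 * Real.pi)) ^ 2 + 2 * (1 / (2 * Real.pi)))) := by
  have hB := tendsto_tripleMean
  have e0 : Tendsto (fun k : ℕ => Real.exp (6 * (k * (1 / 2) ^ k))) atTop (nhds 1) := by
    have h := (tendsto_pow_mul_half_pow 1).const_mul 6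
    rw [mul_zero] at h
    simpa [Function.comp_def] using (Real.continuous_exp.tendsto 0).comp h
  have t1 := ((hB.pow 2).mul (tendsto_exp_half_pow_mul 8)).mul e0
  have t2 := ((hB.pow 2).mul (tendsto_exp_half_pow_mul 8)).mul
    ((tendsto_pow_mul_sqrt_half_pow 2).const_mul (18 * Real.exp 6))
  have t3 := (hB.mul (tendsto_exp_half_pow_mul 4)).mul
    ((((tendsto_pow_mul_sqrt_half_pow 4).const_mul 32).add
      ((tendsto_pow_mul_sqrt_half_pow 3).const_mul 32)).add
      ((tendsto_pow_mul_sqrt_half_pow 2).const_mul 8))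
  have t4 := (hB.mul (tendsto_exp_half_pow_mul 2)).const_mul 2
  have h := ((t1.add t2).add t3).add t4
  simp only [mul_one, mul_zero, add_zero] at h
  refine h.congr fun k => ?_
  rw [secondMomentBound]
  ring

lemma unifProb_le_one (n : ℕ) (Q : SimpleGraph (Fin n) → Prop) : unifProb n Q ≤ 1 := by
  rw [unifProb_eq_graphProb]
  exact graphProb_le_one _

lemma eventually_sq_div_le_unifProb : ∀ᶠ k : ℕ in atTop,
    (tripleMean k * Real.exp (-4 * (1 / 2) ^ k * k)) ^ 2 / secondMomentBound k ≤
      unifProb (2 ^ k * k) (fun G => 0 < Xcount (2 ^ k * k) k k G) := by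
  have h1 : Tendsto (fun k : ℕ => 18 * k * Real.exp 6 * √(1 / 2) ^ k) atTop (nhds 0) := by
    have h := (tendsto_pow_mul_sqrt_half_pow 1).const_mul (18 * Real.exp 6)
    rw [mul_zero] at h
    exact h.congr fun k => by ring
  have h2 : Tendsto (fun k : ℕ => 2 * (2 * k + 1) * k * √(1 / 2) ^ k) atTop (nhds 0) := by
    have h := ((tendsto_pow_mul_sqrt_half_pow 2).const_mul 4).add
      ((tendsto_pow_mul_sqrt_half_pow 1).const_mul 2)
    rw [mul_zero, mul_zero, add_zero] at h
    exact h.congr fun k => by ring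
  have hU : (0 : ℝ) < (1 / (2 * Real.pi)) ^ 2 + 2 * (1 / (2 * Real.pi)) := by positivity
  filter_upwards [eventually_ge_atTop 3, h1.eventually_le_const one_pos,
    h2.eventually_le_const one_pos, tendsto_secondMomentBound.eventually_const_lt hU]
    with k hk hρ hρ' hpos
  rw [div_le_iff₀ hpos]
  exact sq_le_unifProb_mul hk hρ hρ'

lemma tendsto_sq_div : Tendsto
    (fun k : ℕ => (tripleMean k * Real.exp (-4 * (1 / 2) ^ k * k)) ^ 2 / secondMomentBound k)
    atTop (nhds (1 / (4 * Real.pi + 1))) := by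
  have he : Tendsto (fun k : ℕ => Real.exp (-4 * (1 / 2) ^ k * k)) atTop (nhds 1) := by
    have h := (tendsto_pow_mul_half_pow 1).const_mul (-4)
    rw [mul_zero] at h
    have h' := (Real.continuous_exp.tendsto 0).comp h
    rw [Real.exp_zero] at h'
    exact h'.congr fun k => by simp only [Function.comp_apply]; congr 1; ring
  have hU : (1 / (2 * Real.pi)) ^ 2 + 2 * (1 / (2 * Real.pi)) ≠ 0 := by positivity
  have h := ((tendsto_tripleMean.mul he).pow 2).div tendsto_secondMomentBound hU
  rw [show (1 / (2 * Real.pi) * 1) ^ 2 / ((1 / (2 * Real.pi)) ^ 2 + 2 * (1 / (2 * Real.pi))) =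
    1 / (4 * Real.pi + 1) by field_simp; ring] at h
  exact h

end Limits

/-- With `n_k = 2^k k`,
`liminf_{k→∞} P(X(k,k) > 0) ≥ 1/(4π + 1)`. -/
theorem liminf_prob_Xcount_pos :
    1 / (4 * Real.pi + 1) ≤
      Filter.liminf
        (fun k : ℕ => unifProb (2 ^ k * k) (fun G => 0 < Xcount (2 ^ k * k) k k G))
        atTop := by
  rw [← tendsto_sq_div.liminf_eq]
  refine liminf_le_liminf eventually_sq_div_le_unifProb tendsto_sq_div.isBoundedUnder_ge ?_
  exact (isBoundedUnder_of ⟨1, fun k => unifProb_le_one _ _⟩).isCoboundedUnder_ge
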